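/- arXiv:1405.3327 — 2 statements merged into one kernel-verified Lean document; each statement's English description precedes it below -/
import Mathlib

section
/- There exist an integer K₀ and λ > 0, depending only on ψ and L, such that for every K ≥ K₀, every M ∈ ℕ, and every a ∈ ℝ^{KM} with max_i |a_i| ≤ L, the function H̄ : ℝ^M → ℝ defined by H̄(y) = (1/M)∑_{i=1}^M ψ_{K,a^{(i)}}(y_i), where a^{(i)} = (a_{(i−1)K+1},…,a_{iK}), is twice differentiable and uniformly convex with respect to ⟨·,·⟩_Y: for all y, ỹ ∈ ℝ^M, D²H̄(y)[ỹ,ỹ] ≥ λ |ỹ|²_Y. -/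
open MeasureTheory ENNReal Real

noncomputable section

/-- The index of the `j`-th spin of the `i`-th block, for the decomposition `N = K·M`. -/
def blockIdx (K M : ℕ) (i : Fin M) (j : Fin K) : Fin (K * M) :=
  ⟨i.val * K + j.val, by
    have h1 : i.val + 1 ≤ M := i.isLt
    have h2 : j.val < K := j.isLt
    calc i.val * K + j.val < i.val * K + K := by omega
      _ = (i.val + 1) * K := by ring
      _ ≤ M * K := Nat.mul_le_mul_right K h1
      _ = K * M := Nat.mul_comm M K⟩

/-- The coarse-grained single-site potential
`ψ_{K,a}(m) = -(1/K) log ∫_{X_{K,m}} exp(-∑ (aᵢxᵢ + ψ(xᵢ))) dH^{K-1}`. -/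
def psiK (ψ : ℝ → ℝ) (K : ℕ) (a : Fin K → ℝ) (m : ℝ) : ℝ :=
  -(1 / (K : ℝ)) * Real.log
    (∫ x in {x : EuclideanSpace ℝ (Fin K) | ∑ i, x i = (K : ℝ) * m},
      Real.exp (-(∑ i, (a i * x i + ψ (x i)))) ∂μH[(K : ℝ) - 1])

/-- The coarse-grained Hamiltonian `H̄(y) = (1/M) ∑ᵢ ψ_{K,a⁽ⁱ⁾}(yᵢ)`, where
`a⁽ⁱ⁾ = (a_{(i-1)K+1}, …, a_{iK})`. -/
def HbarFun (ψ : ℝ → ℝ) (K M : ℕ) (a : Fin (K * M) → ℝ)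
    (y : EuclideanSpace ℝ (Fin M)) : ℝ :=
  (1 / (M : ℝ)) * ∑ i, psiK ψ K (fun j => a (blockIdx K M i j)) (y i)

theorem norm_prod_le_pow_card {ι : Type*} (s : Finset ι) (a : ι → ℂ) {r : ℝ}
    (ha : ∀ i ∈ s, ‖a i‖ ≤ r) : ‖∏ i ∈ s, a i‖ ≤ r ^ s.card := by
  rw [norm_prod, ← Finset.prod_const]
  exact Finset.prod_le_prod (fun i _ => norm_nonneg _) ha

theorem norm_prod_sub_prod_mul_le {ι : Type*} (s : Finset ι) (a b : ι → ℂ) {r δ : ℝ}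
    (hr : 0 ≤ r) (ha : ∀ i, ‖a i‖ ≤ r) (hb : ∀ i, ‖b i‖ ≤ r) (hab : ∀ i, ‖a i - b i‖ ≤ δ) :
    ‖∏ i ∈ s, a i - ∏ i ∈ s, b i‖ * r ≤ s.card * δ * r ^ s.card := by
  classical
  induction s using Finset.induction with
  | empty => simp
  | insert j t hj ih =>
    rw [Finset.prod_insert hj, Finset.prod_insert hj, Finset.card_insert_of_notMem hj]
    have hδ : 0 ≤ δ := (norm_nonneg _).trans (hab j)
    have h1 : ‖∏ i ∈ t, a i‖ ≤ r ^ t.card := norm_prod_le_pow_card _ _ fun i _ => ha i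
    have h2 : a j * ∏ i ∈ t, a i - b j * ∏ i ∈ t, b i
        = (a j - b j) * ∏ i ∈ t, a i + b j * (∏ i ∈ t, a i - ∏ i ∈ t, b i) := by ring
    have h3 : ‖a j * ∏ i ∈ t, a i - b j * ∏ i ∈ t, b i‖
        ≤ δ * r ^ t.card + r * ‖∏ i ∈ t, a i - ∏ i ∈ t, b i‖ := by
      rw [h2]
      refine (norm_add_le _ _).trans ?_
      rw [norm_mul, norm_mul]
      gcongr
      · exact hab j
      · exact hb j
    calc _ ≤ (δ * r ^ t.card + r * ‖∏ i ∈ t, a i - ∏ i ∈ t, b i‖) * r := by gcongr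
      _ = δ * r ^ (t.card + 1) + r * (‖∏ i ∈ t, a i - ∏ i ∈ t, b i‖ * r) := by ring
      _ ≤ δ * r ^ (t.card + 1) + r * (t.card * δ * r ^ t.card) := by gcongr
      _ = _ := by push_cast; ring

theorem integrable_abs_pow_mul_exp_neg_mul_sq {b : ℝ} (hb : 0 < b) (n : ℕ) :
    Integrable fun x : ℝ => |x| ^ n * exp (-b * x ^ 2) := by
  have h := (integrable_rpow_mul_exp_neg_mul_sq hb (s := n) (by
    have : (0 : ℝ) ≤ n := n.cast_nonneg
    linarith)).norm
  refine h.congr (Filter.Eventually.of_forall fun x => ?_)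
  simp [abs_exp]

theorem norm_prod_le_gaussian {K : ℕ} {c : ℝ} {φ : Fin K → ℝ → ℂ}
    (h1 : ∀ i x, ‖φ i x‖ ≤ exp (-c * min (x ^ 2) 1)) {ξ : ℝ} (hξ : |ξ| ≤ 1) :
    ‖∏ i, φ i ξ‖ ≤ exp (-c * (K * ξ ^ 2)) := by
  have h : ∀ i ∈ Finset.univ, ‖φ i ξ‖ ≤ exp (-c * ξ ^ 2) := fun i _ => by
    have := h1 i ξ
    rwa [min_eq_left (by rw [← sq_abs]; exact pow_le_one₀ (abs_nonneg _) hξ)] at this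
  refine (norm_prod_le_pow_card _ _ h).trans ?_
  rw [Finset.card_univ, Fintype.card_fin, ← Real.exp_nat_mul]
  apply le_of_eq; congr 1; ring

theorem norm_prod_le_tail {K : ℕ} (hK : 4 ≤ K) {c C : ℝ} {φ : Fin K → ℝ → ℂ}
    (h1 : ∀ i x, ‖φ i x‖ ≤ exp (-c * min (x ^ 2) 1)) (h2 : ∀ i x, ‖φ i x‖ * |x| ≤ C)
    {ξ : ℝ} (hξ : 1 < |ξ|) :
    ‖∏ i, φ i ξ‖ ≤ C ^ 4 * exp (4 * c) * exp (-c * K) / ξ ^ 4 := by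
  have hpos : 0 < |ξ| := by linarith
  have h : ∀ i ∈ Finset.univ, ‖φ i ξ‖ ≤ min (exp (-c)) (C / |ξ|) := fun i _ => by
    refine le_min ?_ ?_
    · have := h1 i ξ
      rwa [min_eq_right (by rw [← sq_abs]; exact one_le_pow₀ hξ.le), mul_one] at this
    · rw [le_div_iff₀ hpos]; exact h2 i ξ
  refine (norm_prod_le_pow_card _ _ h).trans ?_
  have hC : 0 ≤ C := (mul_nonneg (norm_nonneg _) (abs_nonneg _)).trans (h2 ⟨0, by omega⟩ ξ)
  have hq : 0 ≤ min (exp (-c)) (C / |ξ|) := le_min (exp_pos _).le (by positivity)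
  rw [Finset.card_univ, Fintype.card_fin]
  obtain ⟨n, rfl⟩ := Nat.exists_eq_add_of_le hK
  rw [pow_add]
  calc _ ≤ (C / |ξ|) ^ 4 * (exp (-c)) ^ n := by
        gcongr
        · exact min_le_right _ _
        · exact min_le_left _ _
    _ = _ := by
      rw [← Real.exp_nat_mul, div_pow, Even.pow_abs (by decide)]
      have : exp (4 * c) * exp (-c * ((4 + n : ℕ) : ℝ)) = exp (n * -c) := by
        rw [← Real.exp_add]; congr 1; push_cast; ring
      rw [mul_assoc (C ^ 4), this]; ring

theorem scaled_tail_le {K : ℕ} (hK : 4 ≤ K) {c C : ℝ} {φ : Fin K → ℝ → ℂ}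
    (h1 : ∀ i x, ‖φ i x‖ ≤ exp (-c * min (x ^ 2) 1)) (h2 : ∀ i x, ‖φ i x‖ * |x| ≤ C)
    {x : ℝ} (hx : √K < |x|) :
    x ^ 2 * ‖∏ i, φ i (x / √K)‖
      ≤ 2 * C ^ 4 * exp (4 * c) * (exp (-c * K) * K ^ 2) * (1 + x ^ 2)⁻¹ := by
  have hK1 : (1 : ℝ) ≤ K := by exact_mod_cast (by omega : 1 ≤ K)
  have hs : 1 ≤ √(K : ℝ) := Real.one_le_sqrt.mpr hK1
  have hs0 : 0 < √(K : ℝ) := by linarith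
  have hξ : 1 < |x / √(K : ℝ)| := by rwa [abs_div, abs_of_pos hs0, one_lt_div hs0]
  have h := norm_prod_le_tail hK h1 h2 hξ
  have hx1 : 1 ≤ x ^ 2 := by rw [← sq_abs]; exact one_le_pow₀ (by linarith)
  have hC : 0 ≤ C := (mul_nonneg (norm_nonneg _) (abs_nonneg _)).trans (h2 ⟨0, by omega⟩ x)
  have h4 : √(K : ℝ) ^ 4 = K ^ 2 := by
    rw [show 4 = 2 * 2 by norm_num, pow_mul, Real.sq_sqrt (by linarith)]
  calc _ ≤ x ^ 2 * (C ^ 4 * exp (4 * c) * exp (-c * K) / (x / √K) ^ 4) := by gcongr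
    _ = C ^ 4 * exp (4 * c) * (exp (-c * K) * K ^ 2) * (x ^ 2)⁻¹ := by
      rw [div_pow, h4]; field_simp
    _ ≤ C ^ 4 * exp (4 * c) * (exp (-c * K) * K ^ 2) * (2 * (1 + x ^ 2)⁻¹) := by
      gcongr
      rw [← div_eq_mul_inv, inv_eq_one_div, div_le_div_iff₀ (by positivity) (by positivity)]
      linarith
    _ = _ := by ring

theorem scaled_norm_prod_le {K : ℕ} (hK : 4 ≤ K) {c C : ℝ} {φ : Fin K → ℝ → ℂ}
    (h1 : ∀ i x, ‖φ i x‖ ≤ exp (-c * min (x ^ 2) 1)) (h2 : ∀ i x, ‖φ i x‖ * |x| ≤ C) (x : ℝ) :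
    (1 + x ^ 2) * ‖∏ i, φ i (x / √K)‖
      ≤ (|x| ^ 0 * exp (-c * x ^ 2) + |x| ^ 2 * exp (-c * x ^ 2))
        + 4 * C ^ 4 * exp (4 * c) * (exp (-c * K) * K ^ 2) * (1 + x ^ 2)⁻¹ := by
  have hK1 : (1 : ℝ) ≤ K := by exact_mod_cast (by omega : 1 ≤ K)
  have hs : 1 ≤ √(K : ℝ) := Real.one_le_sqrt.mpr hK1
  have hs0 : 0 < √(K : ℝ) := by linarith
  have hC : 0 ≤ C := (mul_nonneg (norm_nonneg _) (abs_nonneg _)).trans (h2 ⟨0, by omega⟩ x)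
  rw [pow_zero, one_mul, sq_abs]
  rcases le_or_gt |x| √K with hx | hx
  · have hξ : |x / √(K : ℝ)| ≤ 1 := by rwa [abs_div, abs_of_pos hs0, div_le_one hs0]
    have h := norm_prod_le_gaussian h1 hξ
    have e : (K : ℝ) * (x / √K) ^ 2 = x ^ 2 := by
      rw [div_pow, Real.sq_sqrt (by linarith)]; field_simp
    rw [e] at h
    have : 0 ≤ 4 * C ^ 4 * exp (4 * c) * (exp (-c * K) * K ^ 2) * (1 + x ^ 2)⁻¹ := by positivity
    calc _ ≤ (1 + x ^ 2) * exp (-c * x ^ 2) := by gcongr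
      _ ≤ _ := by linarith
  · have h := scaled_tail_le hK h1 h2 hx
    have hx1 : 1 ≤ x ^ 2 := by rw [← sq_abs]; exact one_le_pow₀ (by linarith)
    have h0 : 0 ≤ exp (-c * x ^ 2) + x ^ 2 * exp (-c * x ^ 2) := by positivity
    have h5 : (1 + x ^ 2) * ‖∏ i, φ i (x / √K)‖ ≤ 2 * (x ^ 2 * ‖∏ i, φ i (x / √K)‖) := by
      nlinarith [norm_nonneg (∏ i, φ i (x / √K))]
    linarith

theorem scaled_gaussian_approx {K : ℕ} (hK : 4 ≤ K) {c C : ℝ} (hc : 0 < c) {φ : Fin K → ℝ → ℂ}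
    {v : Fin K → ℝ}
    (h1 : ∀ i x, ‖φ i x‖ ≤ exp (-c * min (x ^ 2) 1)) (h2 : ∀ i x, ‖φ i x‖ * |x| ≤ C)
    (hv : ∀ i, c ≤ v i)
    (h3 : ∀ i x, |x| ≤ 1 → ‖φ i x - (exp (-v i * x ^ 2) : ℝ)‖ ≤ C * |x| ^ 3) (x : ℝ) :
    x ^ 2 * ‖∏ i, φ i (x / √K) - (exp (-(∑ i, v i) * (x / √K) ^ 2) : ℝ)‖
      ≤ (C * exp c + 1) * (√K)⁻¹ * (|x| ^ 5 * exp (-c * x ^ 2))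
        + 2 * C ^ 4 * exp (4 * c) * (exp (-c * K) * K ^ 2) * (1 + x ^ 2)⁻¹ := by
  have hK1 : (1 : ℝ) ≤ K := by exact_mod_cast (by omega : 1 ≤ K)
  have hs : 1 ≤ √(K : ℝ) := Real.one_le_sqrt.mpr hK1
  have hs0 : 0 < √(K : ℝ) := by linarith
  have hC : 0 ≤ C := (mul_nonneg (norm_nonneg _) (abs_nonneg _)).trans (h2 ⟨0, by omega⟩ x)
  set ξ := x / √(K : ℝ) with hξdef
  have hss : √(K : ℝ) ^ 2 = K := Real.sq_sqrt (by linarith)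
  have e : (K : ℝ) * ξ ^ 2 = x ^ 2 := by
    rw [hξdef, div_pow, hss]; field_simp
  have hprod : ((exp (-(∑ i, v i) * ξ ^ 2) : ℝ) : ℂ) = ∏ i, ((exp (-v i * ξ ^ 2) : ℝ) : ℂ) := by
    rw [← Complex.ofReal_prod, ← Real.exp_sum, ← Finset.sum_mul, Finset.sum_neg_distrib]
  have hexp : ∀ i, ‖((exp (-v i * ξ ^ 2) : ℝ) : ℂ)‖ ≤ exp (-c * ξ ^ 2) := fun i => by
    rw [Complex.norm_real, Real.norm_eq_abs, abs_exp, Real.exp_le_exp]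
    nlinarith [hv i, sq_nonneg ξ]
  have hpow : exp (-c * ξ ^ 2) ^ K = exp (-c * x ^ 2) := by
    rw [← Real.exp_nat_mul, ← e]; congr 1; ring
  rcases le_or_gt |x| √K with hx | hx
  · have hξ : |ξ| ≤ 1 := by rwa [hξdef, abs_div, abs_of_pos hs0, div_le_one hs0]
    have hξ2 : ξ ^ 2 ≤ 1 := by rw [← sq_abs]; exact pow_le_one₀ (abs_nonneg _) hξ
    have hT := norm_prod_sub_prod_mul_le Finset.univ (fun i => φ i ξ)
      (fun i => ((exp (-v i * ξ ^ 2) : ℝ) : ℂ)) (exp_pos (-c * ξ ^ 2)).le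
      (fun i => by have := h1 i ξ; rwa [min_eq_left hξ2] at this) hexp (fun i => h3 i ξ hξ)
    rw [← hprod, Finset.card_univ, Fintype.card_fin, hpow] at hT
    have hr : exp (-c) ≤ exp (-c * ξ ^ 2) := by
      rw [Real.exp_le_exp]; nlinarith
    set D := ‖∏ i, φ i ξ - (exp (-(∑ i, v i) * ξ ^ 2) : ℝ)‖
    have hD : D ≤ exp c * (K * (C * |ξ| ^ 3) * exp (-c * x ^ 2)) := by
      calc D = exp c * (D * exp (-c)) := by
            rw [mul_comm D, ← mul_assoc, ← Real.exp_add]; simp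
        _ ≤ exp c * (D * exp (-c * ξ ^ 2)) := by gcongr
        _ ≤ _ := by gcongr
    have h6 : (K : ℝ) * |ξ| ^ 3 = (√K)⁻¹ * |x| ^ 3 := by
      rw [hξdef, abs_div, abs_of_pos hs0, div_pow]
      nth_rw 1 [← hss]
      field_simp
    have : 0 ≤ 2 * C ^ 4 * exp (4 * c) * (exp (-c * K) * K ^ 2) * (1 + x ^ 2)⁻¹ := by positivity
    have h7 : 0 ≤ (√K)⁻¹ * (|x| ^ 5 * exp (-c * x ^ 2)) := by positivity
    calc x ^ 2 * D ≤ |x| ^ 2 * (exp c * (K * (C * |ξ| ^ 3) * exp (-c * x ^ 2))) := by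
          rw [sq_abs]; gcongr
      _ = |x| ^ 2 * (exp c * (C * (K * |ξ| ^ 3) * exp (-c * x ^ 2))) := by ring
      _ = C * exp c * (√K)⁻¹ * (|x| ^ 5 * exp (-c * x ^ 2)) := by rw [h6]; ring
      _ ≤ _ := by linarith
  · have h := scaled_tail_le hK h1 h2 hx
    have hg : ‖((exp (-(∑ i, v i) * ξ ^ 2) : ℝ) : ℂ)‖ ≤ exp (-c * x ^ 2) := by
      rw [hprod, ← hpow]
      refine (norm_prod_le_pow_card _ _ (fun i _ => hexp i)).trans (by simp)
    have hx1 : 1 ≤ |x| := by linarith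
    have h8 : 1 ≤ (√K)⁻¹ * |x| ^ 3 := by
      rw [inv_mul_eq_div, one_le_div hs0]
      calc √(K : ℝ) ≤ |x| := hx.le
        _ ≤ |x| ^ 3 := le_self_pow₀ hx1 (by norm_num)
    have h7 : 0 ≤ C * exp c * (√K)⁻¹ * (|x| ^ 5 * exp (-c * x ^ 2)) := by positivity
    calc _ ≤ x ^ 2 * (‖∏ i, φ i ξ‖ + exp (-c * x ^ 2)) := by
          gcongr
          exact (norm_sub_le _ _).trans (by gcongr)
      _ = |x| ^ 2 * exp (-c * x ^ 2) * 1 + x ^ 2 * ‖∏ i, φ i ξ‖ := by rw [sq_abs]; ring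
      _ ≤ |x| ^ 2 * exp (-c * x ^ 2) * ((√K)⁻¹ * |x| ^ 3) + x ^ 2 * ‖∏ i, φ i ξ‖ := by
          gcongr
      _ ≤ _ := by nlinarith

theorem integrable_one_add_sq_mul_norm_prod {K : ℕ} (hK : 4 ≤ K) {c C : ℝ} (hc : 0 < c)
    {φ : Fin K → ℝ → ℂ} (hφ : ∀ i, Continuous (φ i))
    (h1 : ∀ i x, ‖φ i x‖ ≤ exp (-c * min (x ^ 2) 1)) (h2 : ∀ i x, ‖φ i x‖ * |x| ≤ C) :
    Integrable (fun x => (1 + x ^ 2) * ‖∏ i, φ i (x / √K)‖) := by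
  refine (((integrable_abs_pow_mul_exp_neg_mul_sq hc 0).add
    (integrable_abs_pow_mul_exp_neg_mul_sq hc 2)).add
    (integrable_inv_one_add_sq.const_mul
      (4 * C ^ 4 * exp (4 * c) * (exp (-c * K) * K ^ 2)))).mono' ?_ ?_
  · apply Continuous.aestronglyMeasurable; fun_prop
  · refine Filter.Eventually.of_forall fun x => ?_
    rw [Real.norm_of_nonneg (by positivity)]
    exact scaled_norm_prod_le hK h1 h2 x

theorem integrable_norm_prod {K : ℕ} (hK : 4 ≤ K) {c C : ℝ} (hc : 0 < c)
    {φ : Fin K → ℝ → ℂ} (hφ : ∀ i, Continuous (φ i))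
    (h1 : ∀ i x, ‖φ i x‖ ≤ exp (-c * min (x ^ 2) 1)) (h2 : ∀ i x, ‖φ i x‖ * |x| ≤ C) :
    Integrable (fun x => (1 + x ^ 2) * ‖∏ i, φ i x‖) := by
  have hK1 : (1 : ℝ) ≤ K := by exact_mod_cast (by omega : 1 ≤ K)
  have hs0 : 0 < √(K : ℝ) := Real.sqrt_pos.mpr (by linarith)
  refine ((integrable_one_add_sq_mul_norm_prod hK hc hφ h1 h2).comp_mul_left' hs0.ne').mono' ?_ ?_
  · apply Continuous.aestronglyMeasurable; fun_prop
  · refine Filter.Eventually.of_forall fun x => ?_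
    rw [Real.norm_of_nonneg (by positivity), mul_div_cancel_left₀ _ hs0.ne', mul_pow,
      Real.sq_sqrt (by linarith)]
    gcongr
    nlinarith [sq_nonneg x]

/-- The local central limit estimate: for a product of `K` functions with Gaussian behaviour near
zero and uniform decay, the second moment dominates the total mass up to a factor `1 / K`. -/
theorem second_moment_prod_ge {c C : ℝ} (hc : 0 < c) (hC : 0 < C) :
    ∃ (K₀ : ℕ) (lam : ℝ), 0 < lam ∧ 4 ≤ K₀ ∧ ∀ K, K₀ ≤ K → ∀ (φ : Fin K → ℝ → ℂ) (v : Fin K → ℝ),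
      (∀ i, Continuous (φ i)) → (∀ i x, ‖φ i x‖ ≤ exp (-c * min (x ^ 2) 1)) →
      (∀ i x, ‖φ i x‖ * |x| ≤ C) → (∀ i, c ≤ v i) → (∀ i, v i ≤ C) →
      (∀ i x, |x| ≤ 1 → ‖φ i x - (exp (-v i * x ^ 2) : ℝ)‖ ≤ C * |x| ^ 3) →
      lam / K * ∫ x, ‖∏ i, φ i x‖ ≤ ∫ x, x ^ 2 * (∏ i, φ i x).re := by
  set c₀ := ∫ x : ℝ, |x| ^ 2 * exp (-C * x ^ 2) with hc₀
  set I₅ := ∫ x : ℝ, |x| ^ 5 * exp (-c * x ^ 2) with hI₅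
  set M := (∫ x : ℝ, (|x| ^ 0 * exp (-c * x ^ 2) + |x| ^ 2 * exp (-c * x ^ 2))) with hM
  have hM0 : 0 ≤ M := integral_nonneg fun x => by positivity
  have hc₀pos : 0 < c₀ := by
    refine (integral_pos_iff_support_of_nonneg (fun x => by positivity)
      (integrable_abs_pow_mul_exp_neg_mul_sq hC 2)).mpr ?_
    have : Function.support (fun x : ℝ => |x| ^ 2 * exp (-C * x ^ 2)) = {0}ᶜ := by
      ext x; simp [(exp_pos _).ne']
    rw [this]
    exact (isOpen_compl_singleton).measure_pos _ ⟨1, by simp⟩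
  have hR : Filter.Tendsto (fun K : ℕ => exp (-c * K) * (K : ℝ) ^ 2) Filter.atTop (nhds 0) := by
    have := (tendsto_rpow_mul_exp_neg_mul_atTop_nhds_zero 2 c hc).comp
      tendsto_natCast_atTop_atTop
    refine this.congr fun K => ?_
    simp [mul_comm]
  have hS : Filter.Tendsto (fun K : ℕ => (√(K : ℝ))⁻¹) Filter.atTop (nhds 0) :=
    (Real.tendsto_sqrt_atTop.comp tendsto_natCast_atTop_atTop).inv_tendsto_atTop
  have hE1 : Filter.Tendsto (fun K : ℕ => 4 * C ^ 4 * exp (4 * c) * (exp (-c * K) * (K : ℝ) ^ 2) * π)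
      Filter.atTop (nhds 0) := by
    simpa using (hR.const_mul (4 * C ^ 4 * exp (4 * c))).mul_const π
  have hE2 : Filter.Tendsto (fun K : ℕ => (C * exp c + 1) * (√(K : ℝ))⁻¹ * I₅ +
      2 * C ^ 4 * exp (4 * c) * (exp (-c * K) * (K : ℝ) ^ 2) * π) Filter.atTop (nhds 0) := by
    simpa using ((hS.const_mul (C * exp c + 1)).mul_const I₅).add
      ((hR.const_mul (2 * C ^ 4 * exp (4 * c))).mul_const π)
  obtain ⟨N, hN⟩ := Filter.eventually_atTop.mp ((hE1.eventually_le_const one_pos).and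
    (hE2.eventually_le_const (half_pos hc₀pos)))
  refine ⟨max N 4, c₀ / 2 / (M + 1), by positivity, le_max_right _ _, ?_⟩
  intro K hK φ v hφ h1 h2 hv hv' h3
  obtain ⟨hb1, hb2⟩ := hN K ((le_max_left _ _).trans hK)
  have hK4 : 4 ≤ K := (le_max_right _ _).trans hK
  have hK1 : (1 : ℝ) ≤ K := by exact_mod_cast (by omega : 1 ≤ K)
  have hs0 : 0 < √(K : ℝ) := Real.sqrt_pos.mpr (by linarith)
  have hss : √(K : ℝ) ^ 2 = K := Real.sq_sqrt (by linarith)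
  have h_int := integrable_one_add_sq_mul_norm_prod hK4 hc hφ h1 h2
  have hcont : Continuous fun x => ∏ i, φ i (x / √K) := by fun_prop
  have hi0 : Integrable fun x => ‖∏ i, φ i (x / √K)‖ := by
    refine h_int.mono' hcont.norm.aestronglyMeasurable (Filter.Eventually.of_forall fun x => ?_)
    rw [norm_norm]
    nlinarith [norm_nonneg (∏ i, φ i (x / √K)), sq_nonneg x]
  have hi2 : Integrable fun x => x ^ 2 * (∏ i, φ i (x / √K)).re := by
    refine h_int.mono' (Continuous.aestronglyMeasurable (by fun_prop))
      (Filter.Eventually.of_forall fun x => ?_)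
    rw [norm_mul, Real.norm_of_nonneg (sq_nonneg x), Real.norm_eq_abs]
    nlinarith [norm_nonneg (∏ i, φ i (x / √K)), sq_nonneg x,
      mul_le_mul_of_nonneg_left (Complex.abs_re_le_norm (∏ i, φ i (x / √K))) (sq_nonneg x)]
  have hupper : ∫ x, ‖∏ i, φ i (x / √K)‖ ≤ M + 1 := by
    have hA : Integrable (fun x : ℝ => |x| ^ 0 * exp (-c * x ^ 2) + |x| ^ 2 * exp (-c * x ^ 2)) :=
      (integrable_abs_pow_mul_exp_neg_mul_sq hc 0).add (integrable_abs_pow_mul_exp_neg_mul_sq hc 2)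
    have hB := integrable_inv_one_add_sq.const_mul
      (4 * C ^ 4 * exp (4 * c) * (exp (-c * K) * K ^ 2))
    calc ∫ x, ‖∏ i, φ i (x / √K)‖ ≤ ∫ x, ((|x| ^ 0 * exp (-c * x ^ 2) + |x| ^ 2 * exp (-c * x ^ 2))
        + 4 * C ^ 4 * exp (4 * c) * (exp (-c * K) * K ^ 2) * (1 + x ^ 2)⁻¹) := by
          refine integral_mono hi0 (hA.add hB) fun x => ?_
          refine le_trans ?_ (scaled_norm_prod_le hK4 h1 h2 x)
          nlinarith [norm_nonneg (∏ i, φ i (x / √K)), sq_nonneg x]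
      _ ≤ M + 1 := by
          rw [integral_add hA hB, integral_const_mul, integral_univ_inv_one_add_sq]
          linarith
  have hlower : c₀ / 2 ≤ ∫ x, x ^ 2 * (∏ i, φ i (x / √K)).re := by
    have hA := (integrable_abs_pow_mul_exp_neg_mul_sq hc 5).const_mul
      ((C * exp c + 1) * (√(K : ℝ))⁻¹)
    have hB := integrable_inv_one_add_sq.const_mul
      (2 * C ^ 4 * exp (4 * c) * (exp (-c * K) * K ^ 2))
    have hG := integrable_abs_pow_mul_exp_neg_mul_sq hC 2
    have hV : ∑ i, v i ≤ K * C := by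
      simpa using Finset.sum_le_sum (s := Finset.univ) fun i _ => hv' i
    have hpt : ∀ x : ℝ, |x| ^ 2 * exp (-C * x ^ 2)
        - ((C * exp c + 1) * (√K)⁻¹ * (|x| ^ 5 * exp (-c * x ^ 2))
          + 2 * C ^ 4 * exp (4 * c) * (exp (-c * K) * K ^ 2) * (1 + x ^ 2)⁻¹)
        ≤ x ^ 2 * (∏ i, φ i (x / √K)).re := fun x => by
      have h := scaled_gaussian_approx hK4 hc h1 h2 hv h3 x
      have hre := (abs_le.mp (Complex.abs_re_le_norm (∏ i, φ i (x / √K) -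
        (exp (-(∑ i, v i) * (x / √K) ^ 2) : ℝ)))).1
      rw [Complex.sub_re, Complex.ofReal_re] at hre
      have hexp : exp (-C * x ^ 2) ≤ exp (-(∑ i, v i) * (x / √K) ^ 2) := by
        rw [Real.exp_le_exp, div_pow, hss]
        have : (∑ i, v i) * (x ^ 2 / K) ≤ K * C * (x ^ 2 / K) := by gcongr
        have e : K * C * (x ^ 2 / K) = C * x ^ 2 := by field_simp
        linarith
      rw [sq_abs]
      nlinarith [mul_le_mul_of_nonneg_left hre (sq_nonneg x),
        mul_le_mul_of_nonneg_left hexp (sq_nonneg x)]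
    have := integral_mono (hG.sub (hA.add hB)) hi2 hpt
    have e2 : ∫ x : ℝ, (|x| ^ 2 * exp (-C * x ^ 2)
        - ((C * exp c + 1) * (√K)⁻¹ * (|x| ^ 5 * exp (-c * x ^ 2))
          + 2 * C ^ 4 * exp (4 * c) * (exp (-c * K) * K ^ 2) * (1 + x ^ 2)⁻¹)) =
        c₀ - ((C * exp c + 1) * (√(K : ℝ))⁻¹ * I₅ +
      2 * C ^ 4 * exp (4 * c) * (exp (-c * K) * (K : ℝ) ^ 2) * π) := by
      refine (integral_sub hG (hA.add hB)).trans ?_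
      rw [integral_add' hA hB, integral_const_mul, integral_const_mul,
        integral_univ_inv_one_add_sq]
    have e3 : c₀ / 2 ≤ c₀ - ((C * exp c + 1) * (√(K : ℝ))⁻¹ * I₅ +
      2 * C ^ 4 * exp (4 * c) * (exp (-c * K) * (K : ℝ) ^ 2) * π) := by linarith
    rw [← e2] at e3
    exact e3.trans this
  have hsub0 := Measure.integral_comp_div (fun x => ‖∏ i, φ i x‖) √(K : ℝ)
  have hsub2 := Measure.integral_comp_div (fun x => x ^ 2 * (∏ i, φ i x).re) √(K : ℝ)
  rw [abs_of_pos hs0, smul_eq_mul] at hsub0 hsub2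
  have e4 : ∫ x, x ^ 2 * (∏ i, φ i (x / √K)).re
      = K * ∫ x, (x / √K) ^ 2 * (∏ i, φ i (x / √K)).re := by
    rw [← integral_const_mul]
    congr 1; ext x
    rw [div_pow, hss]; field_simp
  rw [e4, hsub2] at hlower
  rw [hsub0] at hupper
  set J0 := ∫ x, ‖∏ i, φ i x‖
  set J2 := ∫ x, x ^ 2 * (∏ i, φ i x).re
  have h9 : c₀ / 2 / (M + 1) * (√K * J0) ≤ K * (√K * J2) := by
    refine le_trans ?_ hlower
    calc _ ≤ c₀ / 2 / (M + 1) * (M + 1) := by gcongr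
      _ = _ := by field_simp
  have h10 : c₀ / 2 / (M + 1) * J0 ≤ K * J2 := by
    refine le_of_mul_le_mul_left ?_ hs0
    linarith
  rw [div_mul_eq_mul_div, div_le_iff₀ (by linarith)]
  linarith

theorem abs_sin_le_mul (y : ℝ) : |sin y| ≤ |y| * (1 - min (y ^ 2) 1 / 40) := by
  wlog hy : 0 ≤ y generalizing y
  · have := this (-y) (by linarith)
    simpa using this
  rw [abs_of_nonneg hy]
  have hm := min_le_right (y ^ 2) 1
  rcases le_or_gt y 2 with h | h
  · rw [abs_of_nonneg (sin_nonneg_of_nonneg_of_le_pi hy (by linarith [pi_gt_three]))]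
    have h1 := (abs_le.mp (Real.sin_bound (x := y / 2) (by rw [abs_of_nonneg (by linarith)]; linarith))).2
    rw [abs_of_nonneg (by linarith : 0 ≤ y / 2)] at h1
    have h2 : sin y ≤ 2 * sin (y / 2) := by
      have e : sin y = 2 * sin (y / 2) * cos (y / 2) := by
        rw [← sin_two_mul]; congr 1; ring
      have h3 : 0 ≤ sin (y / 2) := sin_nonneg_of_nonneg_of_le_pi (by linarith)
        (by linarith [pi_gt_three])
      rw [e]
      nlinarith [cos_le_one (y / 2)]
    have h4 : (y / 2) ^ 4 ≤ (y / 2) ^ 3 := pow_le_pow_of_le_one (by linarith) (by linarith)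
      (by norm_num)
    have h5 : y * min (y ^ 2) 1 ≤ y * y ^ 2 := mul_le_mul_of_nonneg_left (min_le_left _ _) hy
    nlinarith [pow_nonneg hy 3]
  · have := abs_sin_le_one y
    nlinarith

theorem integral_one_sub_cos_ge (b γ ξ : ℝ) :
    min (ξ ^ 2) 1 / 40 ≤ ∫ u in b..(b + 1), (1 - cos (2 * π * ξ * u + γ)) := by
  rcases eq_or_ne ξ 0 with rfl | hξ
  · simp only [ne_eq, OfNat.ofNat_ne_zero, not_false_eq_true, zero_pow, zero_le_one,
      inf_of_le_left, zero_div]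
    exact intervalIntegral.integral_nonneg (by linarith) fun u _ => by linarith [cos_le_one (2 * π * 0 * u + γ)]
  have hα : 2 * π * ξ ≠ 0 := by positivity
  rw [intervalIntegral.integral_sub (by simp) (Continuous.intervalIntegrable (by fun_prop) _ _),
    intervalIntegral.integral_comp_mul_add (fun x => cos x) hα, integral_cos, sin_sub_sin]
  have e1 : (2 * π * ξ * (b + 1) + γ - (2 * π * ξ * b + γ)) / 2 = π * ξ := by ring
  rw [e1]
  simp only [intervalIntegral.integral_const, smul_eq_mul]
  set q := cos ((2 * π * ξ * (b + 1) + γ + (2 * π * ξ * b + γ)) / 2)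
  have h1 : (2 * π * ξ)⁻¹ * (2 * sin (π * ξ) * q) ≤ 1 - min ((π * ξ) ^ 2) 1 / 40 := by
    have hp : 0 < |π * ξ| := by positivity
    calc (2 * π * ξ)⁻¹ * (2 * sin (π * ξ) * q) = sin (π * ξ) * q / (π * ξ) := by field_simp
      _ ≤ |sin (π * ξ) * q / (π * ξ)| := le_abs_self _
      _ = |sin (π * ξ)| * |q| / |π * ξ| := by rw [abs_div, abs_mul]
      _ ≤ |π * ξ| * (1 - min ((π * ξ) ^ 2) 1 / 40) * 1 / |π * ξ| := by
        gcongr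
        · exact (abs_nonneg _).trans (abs_sin_le_mul _)
        · exact abs_sin_le_mul _
        · exact abs_cos_le_one _
      _ = _ := by field_simp
  have h2 : min (ξ ^ 2) 1 ≤ min ((π * ξ) ^ 2) 1 := by
    refine min_le_min_right _ ?_
    rw [mul_pow]
    exact le_mul_of_one_le_left (sq_nonneg ξ) (one_le_pow₀ (by linarith [pi_gt_three]))
  linarith

theorem one_add_abs_pow_mul_exp_le (j : ℕ) (u : ℝ) :
    (1 + |u|) ^ j * exp (-|u| / 2) ≤
      exp (1 / 2) * 2 ^ (j + 2) * (j + 2).factorial * (1 + u ^ 2)⁻¹ := by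
  have h := Real.pow_div_factorial_le_exp ((1 + |u|) / 2) (by positivity) (j + 2)
  have h1 : exp ((1 + |u|) / 2) = exp (1 / 2) * exp (|u| / 2) := by
    rw [← exp_add]; congr 1; ring
  rw [h1, div_pow, div_div, div_le_iff₀ (by positivity)] at h
  have h2 : 1 + u ^ 2 ≤ (1 + |u|) ^ 2 := by
    have := sq_abs u
    nlinarith [abs_nonneg u]
  have h3 : exp (-|u| / 2) = (exp (|u| / 2))⁻¹ := by rw [← exp_neg]; congr 1; ring
  rw [h3, ← div_eq_mul_inv, ← div_eq_mul_inv, div_le_div_iff₀ (exp_pos _) (by positivity)]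
  calc (1 + |u|) ^ j * (1 + u ^ 2) ≤ (1 + |u|) ^ j * (1 + |u|) ^ 2 := by gcongr
    _ = (1 + |u|) ^ (j + 2) := by ring
    _ ≤ _ := h
    _ = _ := by ring

theorem integrable_one_add_abs_pow_mul_exp (j : ℕ) :
    Integrable fun u : ℝ => (1 + |u|) ^ j * exp (-|u| / 2) := by
  refine (integrable_inv_one_add_sq.const_mul
    (exp (1 / 2) * 2 ^ (j + 2) * (j + 2).factorial)).mono' ?_ ?_
  · exact Continuous.aestronglyMeasurable (by fun_prop)
  · refine Filter.Eventually.of_forall fun u => ?_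
    rw [Real.norm_of_nonneg (by positivity)]
    exact one_add_abs_pow_mul_exp_le j u

theorem norm_exp_sub_taylor_le (y : ℝ) :
    ‖Complex.exp (y * Complex.I) - (1 + y * Complex.I - (y ^ 2 / 2 : ℝ))‖ ≤ 4 * |y| ^ 3 := by
  rcases le_or_gt |y| 1 with h | h
  · have hn : ‖(y : ℂ) * Complex.I‖ = |y| := by simp
    have := Complex.exp_bound (x := y * Complex.I) (by rwa [hn]) (n := 3) (by norm_num)
    rw [hn] at this
    have e : ∑ m ∈ Finset.range 3, ((y : ℂ) * Complex.I) ^ m / (m.factorial : ℂ)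
        = 1 + y * Complex.I - (y ^ 2 / 2 : ℝ) := by
      simp only [Finset.sum_range_succ, Finset.sum_range_zero, Nat.factorial]
      push_cast
      rw [mul_pow (y : ℂ) Complex.I 2, Complex.I_sq]; ring
    rw [e] at this
    refine this.trans ?_
    rw [mul_comm]
    gcongr
    norm_num [Nat.factorial]
  · have h1 : ‖Complex.exp (y * Complex.I)‖ = 1 := Complex.norm_exp_ofReal_mul_I y
    have h2 : ‖(1 : ℂ) + y * Complex.I - (y ^ 2 / 2 : ℝ)‖ ≤ 1 + |y| + y ^ 2 / 2 := by
      refine (norm_sub_le _ _).trans ?_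
      refine add_le_add ((norm_add_le _ _).trans ?_) ?_
      · simp
      · rw [Complex.norm_real, Real.norm_of_nonneg (by positivity)]
    refine (norm_sub_le _ _).trans ?_
    rw [h1]
    have h6 := sq_abs y
    have h3 : |y| ^ 2 ≤ |y| ^ 3 := pow_le_pow_right₀ h.le (by norm_num)
    have h4 : |y| ≤ |y| ^ 3 := le_self_pow₀ h.le (by norm_num)
    have h5 : 1 ≤ |y| ^ 3 := one_le_pow₀ h.le
    linarith

theorem abs_exp_neg_sub_le {y : ℝ} (hy : 0 ≤ y) : |1 - y - exp (-y)| ≤ y ^ 2 := by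
  rw [abs_le]
  constructor
  · have h : exp (-y) ≤ (1 + y)⁻¹ := by
      rw [exp_neg]
      gcongr
      linarith [add_one_le_exp y]
    have h2 : (1 + y)⁻¹ ≤ 1 - y + y ^ 2 := by
      rw [inv_le_iff_one_le_mul₀ (by positivity)]
      nlinarith [pow_nonneg hy 3]
    linarith
  · nlinarith [add_one_le_exp (-y)]

/-- The barycenter of the density `f`. -/
def densityMean (f : ℝ → ℝ) : ℝ := (∫ x, x * f x) / ∫ x, f x

/-- The characteristic function of the probability density proportional to `f`, centered at its
barycenter. -/
def centeredChar (f : ℝ → ℝ) (ξ : ℝ) : ℂ :=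
  ((∫ x, f x : ℝ) : ℂ)⁻¹ *
    ∫ x, Complex.exp ((-2 * π * (x - densityMean f) * ξ : ℝ) * Complex.I) * (f x : ℂ)

/-- Densities at unit scale, with quantitative bounds: exponential localization, mass on a unit
interval and decay of the Fourier transform. -/
structure IsUnitScale (a A : ℝ) (f : ℝ → ℝ) : Prop where
  cont : Continuous f
  nonneg : ∀ x, 0 ≤ f x
  le_exp : ∀ x, f x ≤ A * exp (-|x| / 2)
  lower : ∃ b, ∀ x ∈ Set.Icc b (b + 1), a ≤ f x
  decay : ∀ ξ : ℝ, ‖∫ x, Complex.exp ((-2 * π * x * ξ : ℝ) * Complex.I) * (f x : ℂ)‖ * |ξ| ≤ A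

namespace IsUnitScale

variable {a A : ℝ} {f : ℝ → ℝ}

theorem upper_nonneg (h : IsUnitScale a A f) : 0 ≤ A :=
  nonneg_of_mul_nonneg_left ((h.nonneg 0).trans (h.le_exp 0)) (exp_pos _)

theorem integrable_pow (h : IsUnitScale a A f) (j : ℕ) :
    Integrable fun x => (1 + |x|) ^ j * f x := by
  have hc := h.cont
  refine ((integrable_one_add_abs_pow_mul_exp j).const_mul A).mono'
    (Continuous.aestronglyMeasurable (by fun_prop)) (Filter.Eventually.of_forall fun x => ?_)
  have := h.nonneg x
  rw [Real.norm_of_nonneg (by positivity)]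
  calc _ ≤ (1 + |x|) ^ j * (A * exp (-|x| / 2)) := by gcongr; exact h.le_exp x
    _ = _ := by ring

theorem integral_pow_le (h : IsUnitScale a A f) (j : ℕ) :
    ∫ x, (1 + |x|) ^ j * f x ≤ A * ∫ x, (1 + |x|) ^ j * exp (-|x| / 2) := by
  rw [← integral_const_mul]
  refine integral_mono (h.integrable_pow j) ((integrable_one_add_abs_pow_mul_exp j).const_mul A)
    fun x => ?_
  calc _ ≤ (1 + |x|) ^ j * (A * exp (-|x| / 2)) := by
        have := h.nonneg x
        gcongr; exact h.le_exp x
    _ = _ := by ring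

theorem integrable (h : IsUnitScale a A f) : Integrable f := by
  simpa using h.integrable_pow 0

theorem integrable_mul {g : ℝ → ℝ} (h : IsUnitScale a A f) (hg : Continuous g) {B : ℝ} {j : ℕ}
    (hgB : ∀ x, |g x| ≤ B * (1 + |x|) ^ j) : Integrable fun x => g x * f x := by
  have hc := h.cont
  refine ((h.integrable_pow j).const_mul B).mono'
    (Continuous.aestronglyMeasurable (by fun_prop)) (Filter.Eventually.of_forall fun x => ?_)
  rw [norm_mul, Real.norm_of_nonneg (h.nonneg x), Real.norm_eq_abs, ← mul_assoc]
  exact mul_le_mul_of_nonneg_right (hgB x) (h.nonneg x)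

theorem setIntegral_le (h : IsUnitScale a A f) {b : ℝ} (hb : ∀ x ∈ Set.Icc b (b + 1), a ≤ f x)
    {g : ℝ → ℝ} (hg : Continuous g) (hg0 : ∀ x, 0 ≤ g x) (hgf : Integrable fun x => g x * f x) :
    a * ∫ x in b..(b + 1), g x ≤ ∫ x, g x * f x := by
  rw [intervalIntegral.integral_of_le (by linarith), ← integral_const_mul]
  calc _ ≤ ∫ x in Set.Ioc b (b + 1), g x * f x := by
        refine setIntegral_mono_on ?_ hgf.integrableOn measurableSet_Ioc fun x hx => ?_
        · exact (Continuous.integrableOn_Ioc (by fun_prop))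
        · rw [mul_comm]
          exact mul_le_mul_of_nonneg_left (hb x ⟨hx.1.le, hx.2⟩) (hg0 x)
    _ ≤ _ := setIntegral_le_integral hgf
        (Filter.Eventually.of_forall fun x => mul_nonneg (hg0 x) (h.nonneg x))

theorem le_integral (h : IsUnitScale a A f) : a ≤ ∫ x, f x := by
  obtain ⟨b, hb⟩ := h.lower
  have := h.setIntegral_le hb (g := fun _ => 1) continuous_const (fun _ => zero_le_one)
    (by simpa using h.integrable)
  simpa using this

theorem abs_densityMean_le (h : IsUnitScale a A f) (ha : 0 < a) :
    |densityMean f| ≤ (A * ∫ x, (1 + |x|) ^ 1 * exp (-|x| / 2)) / a := by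
  have hZ := h.le_integral
  have h1 : |∫ x, x * f x| ≤ A * ∫ x, (1 + |x|) ^ 1 * exp (-|x| / 2) := by
    refine le_trans ?_ (h.integral_pow_le 1)
    refine (abs_integral_le_integral_abs).trans (integral_mono_of_nonneg
      (Filter.Eventually.of_forall fun x => abs_nonneg _) (h.integrable_pow 1)
      (Filter.Eventually.of_forall fun x => ?_))
    simp only [abs_mul, abs_of_nonneg (h.nonneg x), pow_one]
    exact mul_le_mul_of_nonneg_right (by linarith) (h.nonneg x)
  rw [densityMean, abs_div, abs_of_pos (by linarith : 0 < ∫ x, f x)]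
  exact div_le_div₀ ((abs_nonneg _).trans h1) h1 ha hZ

theorem abs_sub_pow_le {μ m : ℝ} (hm : |μ| ≤ m) (j : ℕ) (x : ℝ) :
    |x - μ| ^ j ≤ (1 + m) ^ j * (1 + |x|) ^ j := by
  rw [← mul_pow]
  gcongr
  have hm0 := (abs_nonneg _).trans hm
  refine (abs_sub _ _).trans ?_
  nlinarith [abs_nonneg x, mul_nonneg hm0 (abs_nonneg x)]

theorem continuous_centeredChar (h : IsUnitScale a A f) : Continuous (centeredChar f) := by
  have hc := h.cont
  refine continuous_const.mul (continuous_of_dominated (bound := f)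
    (fun ξ => Continuous.aestronglyMeasurable (by fun_prop)) (fun ξ => ?_) h.integrable ?_)
  · refine Filter.Eventually.of_forall fun x => ?_
    rw [norm_mul, Complex.norm_exp_ofReal_mul_I, one_mul, Complex.norm_real,
      Real.norm_of_nonneg (h.nonneg x)]
  · exact Filter.Eventually.of_forall fun x => by fun_prop

theorem integrable_char (h : IsUnitScale a A f) (μ ξ : ℝ) :
    Integrable fun x => Complex.exp ((-2 * π * (x - μ) * ξ : ℝ) * Complex.I) * (f x : ℂ) := by
  have hc := h.cont
  refine h.integrable.mono' (Continuous.aestronglyMeasurable (by fun_prop))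
    (Filter.Eventually.of_forall fun x => ?_)
  rw [norm_mul, Complex.norm_exp_ofReal_mul_I, one_mul, Complex.norm_real,
      Real.norm_of_nonneg (h.nonneg x)]

theorem norm_centeredChar_mul_le (h : IsUnitScale a A f) (ha : 0 < a) (ξ : ℝ) :
    ‖centeredChar f ξ‖ * |ξ| ≤ A / a := by
  have hZ := h.le_integral
  have e : ∫ x, Complex.exp ((-2 * π * (x - densityMean f) * ξ : ℝ) * Complex.I) * (f x : ℂ)
      = Complex.exp ((2 * π * densityMean f * ξ : ℝ) * Complex.I) *
        ∫ x, Complex.exp ((-2 * π * x * ξ : ℝ) * Complex.I) * (f x : ℂ) := by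
    rw [← integral_const_mul]
    congr 1; ext x
    rw [← mul_assoc, ← Complex.exp_add]
    congr 2; push_cast; ring
  rw [centeredChar, e, norm_mul, norm_mul, Complex.norm_exp_ofReal_mul_I, one_mul, norm_inv,
    Complex.norm_real, Real.norm_of_nonneg (by linarith), mul_assoc, inv_mul_eq_div]
  exact div_le_div₀ h.upper_nonneg (h.decay ξ) ha hZ

theorem norm_centeredChar_le (h : IsUnitScale a A f) (ha : 0 < a) (ξ : ℝ) :
    ‖centeredChar f ξ‖ ≤
      exp (-(a / (40 * (A * ∫ x, (1 + |x|) ^ 0 * exp (-|x| / 2)))) * min (ξ ^ 2) 1) := by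
  have hZ := h.le_integral
  obtain ⟨b, hb⟩ := h.lower
  set Z := ∫ x, f x with hZdef
  have hZ0 : 0 < Z := by linarith
  set w := ∫ x, Complex.exp ((-2 * π * (x - densityMean f) * ξ : ℝ) * Complex.I) * (f x : ℂ) with hw
  obtain ⟨β, hβ⟩ : ∃ β, β = w.arg := ⟨_, rfl⟩
  set γ := 2 * π * (-densityMean f) * ξ + β with hγ
  have hnorm : ‖w‖ = ∫ x, cos (2 * π * ξ * x + γ) * f x := by
    have e1 : (‖w‖ : ℂ) = ∫ x, Complex.exp ((-(2 * π * ξ * x + γ) : ℝ) * Complex.I) * (f x : ℂ) := by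
      have : (‖w‖ : ℂ) = Complex.exp ((-β : ℝ) * Complex.I) * w := by
        rw [hβ]
        conv_rhs => rw [← Complex.norm_mul_exp_arg_mul_I w]
        rw [mul_left_comm, ← Complex.exp_add]
        simp
      rw [this, hw, ← integral_const_mul]
      congr 1; ext x
      rw [← mul_assoc, ← Complex.exp_add]
      congr 2; rw [hγ]; push_cast; ring
    have e2 := congrArg Complex.re e1
    rw [Complex.ofReal_re] at e2
    rw [e2]
    have h_int : Integrable fun x =>
        Complex.exp ((-(2 * π * ξ * x + γ) : ℝ) * Complex.I) * (f x : ℂ) := by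
      have hc := h.cont
      refine h.integrable.mono' (Continuous.aestronglyMeasurable (by fun_prop))
        (Filter.Eventually.of_forall fun x => ?_)
      rw [norm_mul, Complex.norm_exp_ofReal_mul_I, one_mul, Complex.norm_real,
        Real.norm_of_nonneg (h.nonneg x)]
    rw [← RCLike.re_eq_complex_re, ← integral_re h_int]
    congr 1; ext x
    rw [RCLike.re_eq_complex_re, Complex.re_mul_ofReal, Complex.exp_ofReal_mul_I_re, cos_neg]
  have hcosint : Integrable fun x => cos (2 * π * ξ * x + γ) * f x :=
    h.integrable_mul (by fun_prop) (B := 1) (j := 0) fun x => by simpa using abs_cos_le_one _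
  have hsubint : Integrable fun x => (1 - cos (2 * π * ξ * x + γ)) * f x := 
    (h.integrable.sub hcosint).congr (Filter.Eventually.of_forall fun x => by simp [sub_mul])
  have hkey : a * (min (ξ ^ 2) 1 / 40) ≤ Z - ‖w‖ := by
    calc _ ≤ a * ∫ u in b..(b + 1), (1 - cos (2 * π * ξ * u + γ)) := by
          gcongr; exact integral_one_sub_cos_ge b γ ξ
      _ ≤ ∫ x, (1 - cos (2 * π * ξ * x + γ)) * f x := h.setIntegral_le hb (by fun_prop)
          (fun x => by linarith [cos_le_one (2 * π * ξ * x + γ)]) hsubint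
      _ = Z - ‖w‖ := by
          rw [hnorm, hZdef, ← integral_sub h.integrable hcosint]
          congr 1; ext x; ring
  have hZA : Z ≤ A * ∫ x, (1 + |x|) ^ 0 * exp (-|x| / 2) := by simpa using h.integral_pow_le 0
  set A0 := A * ∫ x, (1 + |x|) ^ 0 * exp (-|x| / 2)
  have hmin : 0 ≤ min (ξ ^ 2) 1 := le_min (sq_nonneg _) zero_le_one
  rw [centeredChar, norm_mul, norm_inv, Complex.norm_real, Real.norm_of_nonneg hZ0.le, ← hw,
    inv_mul_eq_div, div_le_iff₀ hZ0]
  have h3 : a / (40 * A0) ≤ a / (40 * Z) := by gcongr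
  have h4 : 1 - a / (40 * A0) * min (ξ ^ 2) 1 ≤ exp (-(a / (40 * A0)) * min (ξ ^ 2) 1) := by
    have := add_one_le_exp (-(a / (40 * A0)) * min (ξ ^ 2) 1)
    linarith
  calc ‖w‖ ≤ Z - a * (min (ξ ^ 2) 1 / 40) := by linarith
    _ = (1 - a / (40 * Z) * min (ξ ^ 2) 1) * Z := by field_simp
    _ ≤ (1 - a / (40 * A0) * min (ξ ^ 2) 1) * Z := by gcongr
    _ ≤ _ := by gcongr

theorem integral_sq_sub_ge (b μ : ℝ) : 1 / 12 ≤ ∫ x in b..(b + 1), (x - μ) ^ 2 := by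
  rw [intervalIntegral.integral_comp_sub_right (fun x => x ^ 2), integral_pow]
  norm_num
  nlinarith [sq_nonneg (2 * (b - μ) + 1)]

/-- The variance of the probability density proportional to `f`, in the normalization of
`centeredChar`. -/
def gaussianCoeff (f : ℝ → ℝ) : ℝ :=
  2 * π ^ 2 * ((∫ x, (x - densityMean f) ^ 2 * f x) / ∫ x, f x)

theorem integrable_sub_pow (h : IsUnitScale a A f) (μ : ℝ) (j : ℕ) :
    Integrable fun x => |x - μ| ^ j * f x :=
  h.integrable_mul (by fun_prop) (B := (1 + |μ|) ^ j) (j := j) fun x => by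
    rw [abs_of_nonneg (by positivity)]
    exact abs_sub_pow_le le_rfl j x

theorem integral_sub_pow_le (h : IsUnitScale a A f) {μ m : ℝ} (hm : |μ| ≤ m) (j : ℕ) :
    ∫ x, |x - μ| ^ j * f x ≤
      (1 + m) ^ j * (A * ∫ x, (1 + |x|) ^ j * exp (-|x| / 2)) := by
  calc _ ≤ ∫ x, (1 + m) ^ j * ((1 + |x|) ^ j * f x) := by
        refine integral_mono (h.integrable_sub_pow μ j) ((h.integrable_pow j).const_mul _)
          fun x => ?_
        simp only
        rw [← mul_assoc]
        exact mul_le_mul_of_nonneg_right (abs_sub_pow_le hm j x) (h.nonneg x)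
    _ ≤ _ := by
        rw [integral_const_mul]
        have hm0 := (abs_nonneg _).trans hm
        gcongr
        exact h.integral_pow_le j

theorem gaussianCoeff_ge (h : IsUnitScale a A f) (ha : 0 < a) :
    a / (12 * (A * ∫ x, (1 + |x|) ^ 0 * exp (-|x| / 2))) ≤ gaussianCoeff f := by
  have hZ := h.le_integral
  have hZA : ∫ x, f x ≤ A * ∫ x, (1 + |x|) ^ 0 * exp (-|x| / 2) := by
    simpa using h.integral_pow_le 0
  obtain ⟨b, hb⟩ := h.lower
  have h1 := h.setIntegral_le hb (g := fun x => (x - densityMean f) ^ 2) (by fun_prop)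
    (fun x => sq_nonneg _) (by simpa using h.integrable_sub_pow (densityMean f) 2)
  have h2 := mul_le_mul_of_nonneg_left (integral_sq_sub_ge b (densityMean f)) ha.le
  have h3 : a * (1 / 12) / (A * ∫ x, (1 + |x|) ^ 0 * exp (-|x| / 2)) ≤
      (∫ x, (x - densityMean f) ^ 2 * f x) / ∫ x, f x :=
    div_le_div₀ (by linarith [mul_pos ha (by norm_num : (0 : ℝ) < 1 / 12)])
      (by linarith) (by linarith) hZA
  have h4 : 1 ≤ 2 * π ^ 2 := by nlinarith [pi_gt_three]
  have h5 : 0 ≤ (∫ x, (x - densityMean f) ^ 2 * f x) / ∫ x, f x := le_trans (by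
    have : 0 < A * ∫ x, (1 + |x|) ^ 0 * exp (-|x| / 2) := by linarith
    positivity) h3
  calc _ = a * (1 / 12) / (A * ∫ x, (1 + |x|) ^ 0 * exp (-|x| / 2)) := by
        rw [mul_one_div, div_div]
    _ ≤ _ := h3
    _ ≤ _ := le_mul_of_one_le_left h5 h4

theorem gaussianCoeff_le (h : IsUnitScale a A f) (ha : 0 < a) {m : ℝ} (hm : |densityMean f| ≤ m) :
    gaussianCoeff f ≤
      2 * π ^ 2 * ((1 + m) ^ 2 * (A * ∫ x, (1 + |x|) ^ 2 * exp (-|x| / 2)) / a) := by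
  have h1 := h.integral_sub_pow_le hm 2
  simp only [sq_abs (_ - densityMean f)] at h1
  have h0 : 0 ≤ ∫ x, (x - densityMean f) ^ 2 * f x :=
    integral_nonneg fun x => mul_nonneg (sq_nonneg _) (h.nonneg x)
  rw [gaussianCoeff]
  gcongr
  · exact h0.trans h1
  · exact h.le_integral

theorem norm_centeredChar_sub_taylor_le (h : IsUnitScale a A f) (ha : 0 < a) {m : ℝ}
    (hm : |densityMean f| ≤ m) (ξ : ℝ) :
    ‖centeredChar f ξ - (1 - gaussianCoeff f * ξ ^ 2 : ℝ)‖ ≤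
      4 * (2 * π) ^ 3 * ((1 + m) ^ 3 * (A * ∫ x, (1 + |x|) ^ 3 * exp (-|x| / 2)) / a) * |ξ| ^ 3 := by
  have hZ := h.le_integral
  set Z := ∫ x, f x with hZdef
  have hZ0 : 0 < Z := by linarith
  set μ := densityMean f with hμ
  have hc := h.cont
  set T : ℝ → ℂ := fun x => (1 + (-2 * π * (x - μ) * ξ : ℝ) * Complex.I
    - ((-2 * π * (x - μ) * ξ) ^ 2 / 2 : ℝ)) * (f x : ℂ) with hT
  have hi1 : Integrable fun x => (x - μ) * f x :=
    h.integrable_mul (by fun_prop) (B := 1 + |μ|) (j := 1) fun x => by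
      simpa using abs_sub_pow_le (le_refl |μ|) 1 x
  have hi2 : Integrable fun x => (x - μ) ^ 2 * f x := by simpa using h.integrable_sub_pow μ 2
  have hT' : T = fun x => ((f x : ℝ) : ℂ) + (-2 * π * ξ * Complex.I) * (((x - μ) * f x : ℝ) : ℂ)
      - (2 * π ^ 2 * ξ ^ 2) * (((x - μ) ^ 2 * f x : ℝ) : ℂ) := by
    ext x; simp only [hT]; push_cast; ring
  have hj0 : Integrable fun x => ((f x : ℝ) : ℂ) := h.integrable.ofReal
  have hj1 : Integrable fun x => (-2 * π * ξ * Complex.I) * (((x - μ) * f x : ℝ) : ℂ) :=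
    hi1.ofReal.const_mul _
  have hj2 : Integrable fun x => ((2 * π ^ 2 * ξ ^ 2) : ℂ) * (((x - μ) ^ 2 * f x : ℝ) : ℂ) :=
    hi2.ofReal.const_mul _
  have hTint : Integrable T := by rw [hT']; exact (hj0.add hj1).sub hj2
  have hmean : ∫ x, (x - μ) * f x = 0 := by
    have hx : Integrable fun x => x * f x :=
      h.integrable_mul (by fun_prop) (B := 1) (j := 1) fun x => by simp
    simp only [sub_mul]
    rw [integral_sub hx (h.integrable.const_mul μ), integral_const_mul, hμ, densityMean, ← hZdef]
    field_simp
    ring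
  have hTval : ∫ x, T x = ((Z * (1 - gaussianCoeff f * ξ ^ 2) : ℝ) : ℂ) := by
    rw [hT']
    refine (integral_sub (hj0.add hj1) hj2).trans ?_
    rw [integral_add' hj0 hj1, integral_const_mul, integral_const_mul, integral_complex_ofReal,
      integral_complex_ofReal, integral_complex_ofReal, hmean, gaussianCoeff, ← hZdef]
    have : (Z : ℂ) ≠ 0 := by exact_mod_cast hZ0.ne'
    push_cast
    field_simp
    ring
  have hdiff : ‖(∫ x, Complex.exp ((-2 * π * (x - μ) * ξ : ℝ) * Complex.I) * (f x : ℂ)) - ∫ x, T x‖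
      ≤ 4 * (2 * π) ^ 3 * |ξ| ^ 3 * ∫ x, |x - μ| ^ 3 * f x := by
    rw [← integral_sub (h.integrable_char μ ξ) hTint, ← integral_const_mul]
    refine norm_integral_le_of_norm_le ((h.integrable_sub_pow μ 3).const_mul _)
      (Filter.Eventually.of_forall fun x => ?_)
    rw [hT, ← sub_mul, norm_mul, Complex.norm_real, Real.norm_of_nonneg (h.nonneg x), ← mul_assoc]
    refine mul_le_mul_of_nonneg_right ?_ (h.nonneg x)
    refine (norm_exp_sub_taylor_le _).trans (le_of_eq ?_)
    rw [abs_mul, abs_mul, abs_mul, abs_of_pos pi_pos, abs_neg, abs_two]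
    ring
  have e : centeredChar f ξ - (1 - gaussianCoeff f * ξ ^ 2 : ℝ) = (Z : ℂ)⁻¹ *
      ((∫ x, Complex.exp ((-2 * π * (x - μ) * ξ : ℝ) * Complex.I) * (f x : ℂ)) - ∫ x, T x) := by
    have : (Z : ℂ) ≠ 0 := by exact_mod_cast hZ0.ne'
    rw [hTval, centeredChar, mul_sub, ← hZdef, ← hμ, Complex.ofReal_mul, inv_mul_cancel_left₀ this]
  rw [e, norm_mul, norm_inv, Complex.norm_real, Real.norm_of_nonneg hZ0.le, inv_mul_eq_div]
  have h3 := h.integral_sub_pow_le hm 3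
  have h30 : 0 ≤ ∫ x, |x - μ| ^ 3 * f x :=
    integral_nonneg fun x => mul_nonneg (by positivity) (h.nonneg x)
  calc _ ≤ 4 * (2 * π) ^ 3 * |ξ| ^ 3 * (∫ x, |x - μ| ^ 3 * f x) / Z := by gcongr
    _ = 4 * (2 * π) ^ 3 * ((∫ x, |x - μ| ^ 3 * f x) / Z) * |ξ| ^ 3 := by ring
    _ ≤ _ := by
      gcongr
      exact h30.trans h3

end IsUnitScale

/-- Uniform characteristic function bounds for densities at unit scale. -/
theorem exists_centeredChar_bounds {a A : ℝ} (ha : 0 < a) (hA : 0 < A) :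
    ∃ c C : ℝ, 0 < c ∧ 0 < C ∧ ∀ f, IsUnitScale a A f →
      (∀ ξ, ‖centeredChar f ξ‖ ≤ exp (-c * min (ξ ^ 2) 1)) ∧
      (∀ ξ, ‖centeredChar f ξ‖ * |ξ| ≤ C) ∧
      ∃ v, c ≤ v ∧ v ≤ C ∧
        ∀ ξ, |ξ| ≤ 1 → ‖centeredChar f ξ - (exp (-v * ξ ^ 2) : ℝ)‖ ≤ C * |ξ| ^ 3 := by
  set I : ℕ → ℝ := fun j => A * ∫ x, (1 + |x|) ^ j * exp (-|x| / 2) with hI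
  have hIpos : ∀ j, 0 < I j := fun j => by
    refine mul_pos hA ((integral_pos_iff_support_of_nonneg (fun x => by positivity)
      (integrable_one_add_abs_pow_mul_exp j)).mpr ?_)
    have : Function.support (fun u : ℝ => (1 + |u|) ^ j * exp (-|u| / 2)) = Set.univ := by
      ext x
      simp only [Function.mem_support, Set.mem_univ, iff_true]
      positivity
    rw [this]; simp
  set m := I 1 / a with hm
  have hm0 : 0 < m := div_pos (hIpos 1) ha
  set V := 2 * π ^ 2 * ((1 + m) ^ 2 * I 2 / a) with hV
  set W := 4 * (2 * π) ^ 3 * ((1 + m) ^ 3 * I 3 / a) with hW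
  have := hIpos 0; have := hIpos 2; have := hIpos 3
  have hV0 : 0 < V := by positivity
  have hW0 : 0 < W := by positivity
  refine ⟨a / (40 * I 0), A / a + V + W + V ^ 2, by positivity, by positivity, fun f h => ?_⟩
  have hmean := h.abs_densityMean_le ha
  have hv1 := h.gaussianCoeff_ge ha
  have hv2 := h.gaussianCoeff_le ha hmean
  have hAa : 0 < A / a := by positivity
  refine ⟨h.norm_centeredChar_le ha, fun ξ => (h.norm_centeredChar_mul_le ha ξ).trans ?_,
    IsUnitScale.gaussianCoeff f, le_trans ?_ hv1, hv2.trans ?_, fun ξ hξ => ?_⟩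
  · nlinarith
  · change a / (40 * I 0) ≤ a / (12 * I 0)
    gcongr
    norm_num
  · change V ≤ _
    nlinarith
  · have h1 := h.norm_centeredChar_sub_taylor_le ha hmean ξ
    set v := IsUnitScale.gaussianCoeff f
    have hv0 : 0 ≤ v := le_trans (by positivity : 0 ≤ a / (12 * I 0)) hv1
    have h2 := abs_exp_neg_sub_le (y := v * ξ ^ 2) (by positivity)
    have h3 : (v * ξ ^ 2) ^ 2 ≤ V ^ 2 * |ξ| ^ 3 := by
      calc (v * ξ ^ 2) ^ 2 = v ^ 2 * |ξ| ^ 4 := by rw [Even.pow_abs (by decide)]; ring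
        _ ≤ V ^ 2 * |ξ| ^ 3 := by
          have : |ξ| ^ 4 ≤ |ξ| ^ 3 := pow_le_pow_of_le_one (abs_nonneg _) hξ (by norm_num)
          exact mul_le_mul (pow_le_pow_left₀ hv0 hv2 2) this (by positivity) (by positivity)
    have h4 : ‖((1 - v * ξ ^ 2 : ℝ) : ℂ) - (exp (-v * ξ ^ 2) : ℝ)‖ ≤ V ^ 2 * |ξ| ^ 3 := by
      rw [← Complex.ofReal_sub, Complex.norm_real, Real.norm_eq_abs, neg_mul]
      exact h2.trans h3
    have h5 : 0 ≤ (A / a + V) * |ξ| ^ 3 := by positivity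
    calc _ ≤ ‖centeredChar f ξ - (1 - v * ξ ^ 2 : ℝ)‖
          + ‖((1 - v * ξ ^ 2 : ℝ) : ℂ) - (exp (-v * ξ ^ 2) : ℝ)‖ := norm_sub_le_norm_sub_add_norm_sub _ _ _
      _ ≤ W * |ξ| ^ 3 + V ^ 2 * |ξ| ^ 3 := add_le_add h1 h4
      _ ≤ _ := by linarith

theorem integral_deriv_mul_exp_neg_half_le {k k' : ℝ → ℝ} (hk : ∀ u, HasDerivAt k (k' u) u)
    (hk0 : ∀ u, 0 ≤ k u) (hpos : ∀ u, 0 ≤ u → 0 ≤ k' u) (hgrow : ∀ u, 1 ≤ u → u ≤ k u) :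
    IntegrableOn (fun u => |k' u| * exp (-k u / 2)) (Set.Ioi 0) ∧
      ∫ u in Set.Ioi 0, |k' u| * exp (-k u / 2) ≤ 2 := by
  have hd : ∀ u ∈ Set.Ici (0 : ℝ), HasDerivAt (fun u => -2 * exp (-k u / 2))
      (|k' u| * exp (-k u / 2)) u := fun u hu => by
    refine ((((hk u).neg.div_const 2).exp).const_mul (-2)).congr_deriv ?_
    rw [abs_of_nonneg (hpos u hu), Pi.neg_apply]
    ring
  have hn : ∀ u ∈ Set.Ioi (0 : ℝ), 0 ≤ |k' u| * exp (-k u / 2) := fun u _ => by positivity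
  have hlim : Filter.Tendsto (fun u => -2 * exp (-k u / 2)) Filter.atTop (nhds 0) := by
    have : Filter.Tendsto (fun u => -k u / 2) Filter.atTop Filter.atBot := by
      refine Filter.tendsto_atBot_mono' _ (f₂ := fun u => -k u / 2) (f₁ := fun u => -u / 2) ?_ ?_
      · filter_upwards [Filter.eventually_ge_atTop 1] with u hu
        linarith [hgrow u hu]
      · exact (Filter.tendsto_neg_atTop_atBot).atBot_div_const (by norm_num)
    simpa using (tendsto_exp_atBot.comp this).const_mul (-2)
  refine ⟨integrableOn_Ioi_deriv_of_nonneg' hd hn hlim, ?_⟩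
  rw [integral_Ioi_of_hasDerivAt_of_nonneg' hd hn hlim]
  have : exp (-k 0 / 2) ≤ 1 := exp_le_one_iff.mpr (by linarith [hk0 0])
  linarith

theorem integral_abs_deriv_mul_exp_neg_half_le {k k' : ℝ → ℝ} (hk : ∀ u, HasDerivAt k (k' u) u)
    (hk0 : ∀ u, 0 ≤ k u) (hpos : ∀ u, 0 ≤ u → 0 ≤ k' u) (hneg : ∀ u, u ≤ 0 → k' u ≤ 0)
    (hgrow : ∀ u, 1 ≤ |u| → |u| ≤ k u) :
    Integrable (fun u => |k' u| * exp (-k u / 2)) ∧ ∫ u, |k' u| * exp (-k u / 2) ≤ 4 := by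
  obtain ⟨hi1, h1⟩ := integral_deriv_mul_exp_neg_half_le hk hk0 hpos fun u hu => by
    simpa [abs_of_nonneg (by linarith : 0 ≤ u)] using
      hgrow u (by rwa [abs_of_nonneg (by linarith)])
  obtain ⟨hi2, h2⟩ := integral_deriv_mul_exp_neg_half_le (k := fun u => k (-u))
    (k' := fun u => -k' (-u)) (fun u => by
      simpa [Function.comp_def] using (hk (-u)).comp u (hasDerivAt_neg u)) (fun u => hk0 _)
    (fun u hu => by linarith [hneg (-u) (by linarith)]) fun u hu => by
      simpa [abs_of_nonneg (by linarith : 0 ≤ u)] using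
        hgrow (-u) (by rwa [abs_neg, abs_of_nonneg (by linarith)])
  simp only [abs_neg] at hi2 h2
  rw [integral_comp_neg_Ioi 0 (fun u => |k' u| * exp (-k u / 2)), neg_zero] at h2
  have hi2' : IntegrableOn (fun u => |k' u| * exp (-k u / 2)) (Set.Iic 0) := by
    rw [integrableOn_Iic_iff_integrableOn_Iio]
    have := hi2.comp_neg
    simpa using this
  have hi : Integrable (fun u => |k' u| * exp (-k u / 2)) := by
    rw [← integrableOn_univ, ← Set.Iic_union_Ioi (a := (0 : ℝ))]
    exact hi2'.union hi1
  refine ⟨hi, ?_⟩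
  rw [← intervalIntegral.integral_Iic_add_Ioi hi2' hi1]
  linarith

theorem norm_fourier_mul_abs_le {f f' : ℝ → ℝ} (hf : ∀ x, HasDerivAt f (f' x) x)
    (hfi : Integrable f) (hfi' : Integrable f') (ξ : ℝ) :
    ‖∫ x, Complex.exp ((-2 * π * x * ξ : ℝ) * Complex.I) * (f x : ℂ)‖ * |ξ| ≤ ∫ x, |f' x| := by
  have hd : deriv (fun x => (f x : ℂ)) = fun x => (f' x : ℂ) :=
    funext fun x => (hf x).ofReal_comp.deriv
  have h := congrFun (fourier_deriv (f := fun x => (f x : ℂ)) hfi.ofReal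
    (fun x => (hf x).ofReal_comp.differentiableAt) (by rw [hd]; exact hfi'.ofReal)) ξ
  rw [hd, fourier_real_eq_integral_exp_smul, fourier_real_eq_integral_exp_smul] at h
  simp only [smul_eq_mul] at h
  set w := ∫ x, Complex.exp ((-2 * π * x * ξ : ℝ) * Complex.I) * (f x : ℂ)
  have h1 := congrArg norm h
  have h2 : ‖∫ x, Complex.exp ((-2 * π * x * ξ : ℝ) * Complex.I) * (f' x : ℂ)‖ ≤ ∫ x, |f' x| := by
    refine (norm_integral_le_integral_norm _).trans (le_of_eq ?_)
    congr 1; ext x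
    rw [norm_mul, Complex.norm_exp_ofReal_mul_I, one_mul, Complex.norm_real, Real.norm_eq_abs]
  rw [h1] at h2
  simp only [norm_mul, Complex.norm_real, Complex.norm_I, Real.norm_eq_abs, abs_of_pos pi_pos,
    RCLike.norm_ofNat, mul_one] at h2
  have : 0 ≤ |ξ| * ‖w‖ := by positivity
  nlinarith [pi_gt_three]

/-- Exponentials of perturbed unimodal potentials at unit scale. -/
theorem exists_isUnitScale_exp_neg {D E : ℝ} (hE : 0 ≤ E) :
    ∃ a A, 0 < a ∧ 0 < A ∧ ∀ k g k' g' : ℝ → ℝ, (∀ u, HasDerivAt k (k' u) u) →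
      (∀ u, HasDerivAt g (g' u) u) → Continuous k' → Continuous g' → (∀ u, 0 ≤ k u) →
      (∀ u, 0 ≤ u → 0 ≤ k' u) → (∀ u, u ≤ 0 → k' u ≤ 0) → (∀ u, 1 ≤ |u| → |u| ≤ k u) →
      (∃ b, ∀ u ∈ Set.Icc b (b + 1), k u ≤ 1 ∧ g u ≤ E) → (∀ u, |g u| ≤ k u / 2 + D) →
      (∀ u, |g' u| ≤ E) → IsUnitScale a A fun u => exp (-(k u + g u)) := by
  set A₁ := exp (D + 1 / 2) with hA₁
  set J := ∫ x : ℝ, (1 + |x|) ^ 0 * exp (-|x| / 2) with hJ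
  have hJ0 : 0 ≤ J := integral_nonneg fun x => by positivity
  refine ⟨exp (-(1 + E)), A₁ + (exp D * 4 + E * (A₁ * J)), exp_pos _, by positivity,
    fun k g k' g' hk hg hk'c hg'c hk0 hpos hneg hgrow hb hgk hgE => ?_⟩
  have hkc : Continuous k := continuous_iff_continuousAt.mpr fun u => (hk u).continuousAt
  have hgc : Continuous g := continuous_iff_continuousAt.mpr fun u => (hg u).continuousAt
  have hf1 : ∀ u, exp (-(k u + g u)) ≤ exp D * exp (-k u / 2) := fun u => by
    rw [← exp_add]; exact exp_le_exp.mpr (by linarith [neg_abs_le (g u), hgk u])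
  have hf2 : ∀ u, exp (-(k u + g u)) ≤ A₁ * exp (-|u| / 2) := fun u => by
    refine (hf1 u).trans ?_
    rw [hA₁, ← exp_add, ← exp_add]
    refine exp_le_exp.mpr ?_
    rcases le_total 1 |u| with h | h
    · linarith [hgrow u h]
    · linarith [hk0 u]
  have hexp : Integrable fun u : ℝ => A₁ * exp (-|u| / 2) := by
    simpa using (integrable_one_add_abs_pow_mul_exp 0).const_mul A₁
  have hfi : Integrable fun u => exp (-(k u + g u)) :=
    hexp.mono' (Continuous.aestronglyMeasurable (by fun_prop))
      (Filter.Eventually.of_forall fun u => by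
        rw [Real.norm_of_nonneg (exp_pos _).le]; exact hf2 u)
  have hd : ∀ u, HasDerivAt (fun u => exp (-(k u + g u)))
      (exp (-(k u + g u)) * -(k' u + g' u)) u := fun u => ((hk u).add (hg u)).neg.exp
  obtain ⟨hi, hi4⟩ := integral_abs_deriv_mul_exp_neg_half_le hk hk0 hpos hneg hgrow
  have hbound : ∀ u, |exp (-(k u + g u)) * -(k' u + g' u)| ≤
      exp D * (|k' u| * exp (-k u / 2)) + E * (A₁ * exp (-|u| / 2)) := fun u => by
    rw [abs_mul, abs_neg, abs_of_pos (exp_pos _)]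
    calc _ ≤ exp (-(k u + g u)) * (|k' u| + |g' u|) := by gcongr; exact abs_add_le _ _
      _ = exp (-(k u + g u)) * |k' u| + exp (-(k u + g u)) * |g' u| := mul_add _ _ _
      _ ≤ exp D * exp (-k u / 2) * |k' u| + A₁ * exp (-|u| / 2) * E := by
        gcongr
        · exact hf1 u
        · exact hf2 u
        · exact hgE u
      _ = _ := by ring
  have hbi := (hi.const_mul (exp D)).add (hexp.const_mul E)
  have hfi' : Integrable fun u => exp (-(k u + g u)) * -(k' u + g' u) :=
    hbi.mono' (Continuous.aestronglyMeasurable (by fun_prop)) (Filter.Eventually.of_forall hbound)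
  refine ⟨by fun_prop, fun u => (exp_pos _).le, fun u => (hf2 u).trans ?_, ?_, fun ξ => ?_⟩
  · have : 0 ≤ exp D * 4 + E * (A₁ * J) := by positivity
    gcongr
    linarith
  · obtain ⟨b, hb⟩ := hb
    exact ⟨b, fun u hu => exp_le_exp.mpr (by linarith [(hb u hu).1, (hb u hu).2])⟩
  · refine (norm_fourier_mul_abs_le hd hfi hfi' ξ).trans ?_
    have h1 := integral_mono hfi'.abs hbi hbound
    refine h1.trans ?_
    rw [integral_add' (hi.const_mul _) (hexp.const_mul _), integral_const_mul, integral_const_mul,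
      integral_const_mul]
    have h2 : J = ∫ x : ℝ, exp (-|x| / 2) := by simp [hJ]
    rw [← h2]
    have : exp D * ∫ u, |k' u| * exp (-k u / 2) ≤ exp D * 4 := by gcongr
    have := exp_pos (D + 1 / 2)
    linarith

theorem mul_sub_le_sub_of_le_deriv {p : ℝ → ℝ} {l : ℝ} (hp : Differentiable ℝ p)
    (hl : ∀ x, l ≤ deriv p x) {x y : ℝ} (hxy : x ≤ y) : l * (y - x) ≤ p y - p x :=
  (convex_univ : Convex ℝ (Set.univ : Set ℝ)).mul_sub_le_image_sub_of_le_deriv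
    hp.continuous.continuousOn hp.differentiableOn (fun z _ => hl z) x trivial y trivial hxy

theorem exists_deriv_eq_zero_of_le_deriv2 {h : ℝ → ℝ} {l : ℝ} (hl : 0 < l) (hh : ContDiff ℝ 2 h)
    (hd : ∀ x, l ≤ deriv (deriv h) x) : ∃ x₀, deriv h x₀ = 0 := by
  have hc : ContDiff ℝ 1 (deriv h) := hh.deriv'
  have hdiff : Differentiable ℝ (deriv h) := hc.differentiable one_ne_zero
  have h1 : l * (|deriv h 0| / l) = |deriv h 0| := by field_simp
  have h0 : 0 ≤ |deriv h 0| / l := by positivity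
  refine mem_range_of_exists_le_of_exists_ge hc.continuous
    ⟨-(|deriv h 0| / l), ?_⟩ ⟨|deriv h 0| / l, ?_⟩
  · have := mul_sub_le_sub_of_le_deriv hdiff hd (neg_nonpos.mpr h0)
    rw [sub_neg_eq_add, zero_add, h1] at this
    linarith [le_abs_self (deriv h 0)]
  · have := mul_sub_le_sub_of_le_deriv hdiff hd h0
    rw [sub_zero, h1] at this
    linarith [neg_abs_le (deriv h 0)]

section Well

variable {r : ℝ → ℝ} {l : ℝ}

theorem mul_le_deriv_of_well (hr : ContDiff ℝ 2 r) (hd : ∀ x, l ≤ deriv (deriv r) x)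
    (hr0 : deriv r 0 = 0) {t : ℝ} (ht : 0 ≤ t) : l * t ≤ deriv r t := by
  have hdiff : Differentiable ℝ (deriv r) := hr.deriv'.differentiable one_ne_zero
  simpa [hr0] using mul_sub_le_sub_of_le_deriv hdiff hd ht

theorem deriv_le_mul_of_well (hr : ContDiff ℝ 2 r) (hd : ∀ x, l ≤ deriv (deriv r) x)
    (hr0 : deriv r 0 = 0) {t : ℝ} (ht : t ≤ 0) : deriv r t ≤ l * t := by
  have hdiff : Differentiable ℝ (deriv r) := hr.deriv'.differentiable one_ne_zero
  have := mul_sub_le_sub_of_le_deriv hdiff hd ht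
  rw [hr0] at this
  linarith

theorem well_sub_deriv (hr : ContDiff ℝ 2 r) (t : ℝ) :
    HasDerivAt (fun t => r t - l / 2 * t ^ 2) (deriv r t - l * t) t := by
  refine (((hr.differentiable two_ne_zero) t).hasDerivAt.sub
    ((hasDerivAt_pow 2 t).const_mul (l / 2))).congr_deriv ?_
  push_cast; ring

theorem well_monotoneOn (hr : ContDiff ℝ 2 r) (hd : ∀ x, l ≤ deriv (deriv r) x)
    (hr0 : deriv r 0 = 0) : MonotoneOn (fun t => r t - l / 2 * t ^ 2) (Set.Ici 0) := by
  have hc := hr.continuous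
  refine monotoneOn_of_deriv_nonneg (convex_Ici 0) (by fun_prop)
    (fun t _ => (well_sub_deriv hr t).differentiableAt.differentiableWithinAt) fun t ht => ?_
  rw [interior_Ici, Set.mem_Ioi] at ht
  rw [(well_sub_deriv hr t).deriv]
  linarith [mul_le_deriv_of_well hr hd hr0 ht.le]

theorem well_antitoneOn (hr : ContDiff ℝ 2 r) (hd : ∀ x, l ≤ deriv (deriv r) x)
    (hr0 : deriv r 0 = 0) : AntitoneOn (fun t => r t - l / 2 * t ^ 2) (Set.Iic 0) := by
  have hc := hr.continuous
  refine antitoneOn_of_deriv_nonpos (convex_Iic 0) (by fun_prop)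
    (fun t _ => (well_sub_deriv hr t).differentiableAt.differentiableWithinAt) fun t ht => ?_
  rw [interior_Iic, Set.mem_Iio] at ht
  rw [(well_sub_deriv hr t).deriv]
  linarith [deriv_le_mul_of_well hr hd hr0 ht.le]

theorem well_ge (hr : ContDiff ℝ 2 r) (hd : ∀ x, l ≤ deriv (deriv r) x)
    (hr0 : deriv r 0 = 0) (h0 : r 0 = 0) (t : ℝ) : l / 2 * t ^ 2 ≤ r t := by
  rcases le_total 0 t with ht | ht
  · have := well_monotoneOn hr hd hr0 Set.self_mem_Ici ht ht
    simp only [h0] at this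
    linarith
  · have := well_antitoneOn hr hd hr0 ht Set.self_mem_Iic ht
    simp only [h0] at this
    linarith

theorem well_convexOn (hl : 0 < l) (hr : ContDiff ℝ 2 r) (hd : ∀ x, l ≤ deriv (deriv r) x) :
    ConvexOn ℝ Set.univ r :=
  convexOn_univ_of_deriv2_nonneg (hr.differentiable two_ne_zero)
    (hr.deriv'.differentiable one_ne_zero) fun x => hl.le.trans (hd x)

/-- The natural length scale of a strictly convex well. -/
theorem exists_well_scale (hl : 0 < l) (hr : ContDiff ℝ 2 r) (hd : ∀ x, l ≤ deriv (deriv r) x)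
    (hr0 : deriv r 0 = 0) (h0 : r 0 = 0) :
    ∃ τ, 0 < τ ∧ τ ≤ √(2 / l) ∧ (∀ u, 1 ≤ |u| → |u| ≤ r (τ * u)) ∧
      ∃ b, ∀ u ∈ Set.Icc b (b + 1), |u| ≤ 1 ∧ r (τ * u) ≤ 1 := by
  have hc := hr.continuous
  have hT : l / 2 * √(2 / l) ^ 2 = 1 := by
    rw [sq_sqrt (by positivity)]; field_simp
  obtain ⟨τ, hτ, hq⟩ := intermediate_value_Icc (f := fun t => min (r t) (r (-t)))
    (sqrt_nonneg (2 / l)) (by fun_prop)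
    (show (1 : ℝ) ∈ _ by
      refine ⟨by simp [h0], le_min ?_ ?_⟩
      · linarith [well_ge hr hd hr0 h0 √(2 / l)]
      · linarith [well_ge hr hd hr0 h0 (-√(2 / l)), neg_sq √(2 / l)])
  simp only at hq
  have hτ0 : 0 < τ := by
    refine lt_of_le_of_ne hτ.1 fun h => ?_
    rw [← h] at hq
    simp [h0] at hq
  have hge1 : 1 ≤ r τ := hq ▸ min_le_left _ _
  have hge2 : 1 ≤ r (-τ) := hq ▸ min_le_right _ _
  refine ⟨τ, hτ0, hτ.2, fun u hu => ?_, ?_⟩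
  · have key : ∀ s : ℝ, |s| = τ → 1 ≤ r s → s * |u| = τ * u → |u| ≤ r (τ * u) := by
      intro s hs h1 hsu
      have hu0 : 0 < |u| := by linarith
      have := (well_convexOn hl hr hd).2 (Set.mem_univ 0) (Set.mem_univ (τ * u))
        (show 0 ≤ 1 - 1 / |u| by rw [sub_nonneg, div_le_one hu0]; exact hu) (show 0 ≤ 1 / |u| by positivity) (by ring)
      rw [smul_zero, zero_add, h0, smul_zero, zero_add, smul_eq_mul, smul_eq_mul, ← hsu] at this
      have e : 1 / |u| * (s * |u|) = s := by field_simp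
      rw [e, hsu, one_div, inv_mul_eq_div, le_div_iff₀ hu0] at this
      nlinarith
    rcases abs_cases u with ⟨h, _⟩ | ⟨h, _⟩
    · exact key τ (abs_of_pos hτ0) hge1 (by rw [h])
    · exact key (-τ) (by rw [abs_neg, abs_of_pos hτ0]) hge2 (by rw [h]; ring)
  · rcases min_choice (r τ) (r (-τ)) with h | h
    · refine ⟨0, fun u hu => ?_⟩
      have h2 : u ≤ 1 := by linarith [hu.2]
      have hu0 := hu.1
      have h3 : τ * u ≤ τ := by nlinarith
      have := well_monotoneOn hr hd hr0 (a := τ * u) (b := τ)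
        (mul_nonneg hτ0.le hu.1) hτ0.le h3
      simp only at this
      have h4 : l / 2 * (τ * u) ^ 2 ≤ l / 2 * τ ^ 2 := by
        gcongr
      exact ⟨abs_le.mpr ⟨by linarith, h2⟩, by linarith⟩
    · refine ⟨-1, fun u hu => ?_⟩
      have h2 : -1 ≤ u := hu.1
      have hu0 : u ≤ 0 := by linarith [hu.2]
      have h3 : -τ ≤ τ * u := by nlinarith
      have := well_antitoneOn hr hd hr0 (a := -τ) (b := τ * u) (neg_nonpos.mpr hτ0.le)
        (mul_nonpos_of_nonneg_of_nonpos hτ0.le hu0) h3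
      simp only at this
      have h4 : l / 2 * (τ * u) ^ 2 ≤ l / 2 * (-τ) ^ 2 := by
        have : (τ * u) ^ 2 ≤ (-τ) ^ 2 := by nlinarith [mul_nonpos_of_nonneg_of_nonpos hτ0.le hu0]
        gcongr
      exact ⟨abs_le.mpr ⟨h2, by linarith⟩, by linarith⟩

end Well

/-- The exponentially tilted single-site density. -/
def siteDensity (ψ : ℝ → ℝ) (α σ x : ℝ) : ℝ := exp (σ * x - (α * x + ψ x))

theorem exists_siteDensity_scale {ψ ψc δψ : ℝ → ℝ} {lam0 B L : ℝ}
    (hlam0 : 0 < lam0) (hB : 0 ≤ B) (hL : 0 < L)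
    (hsplit : ∀ x, ψ x = ψc x + δψ x)
    (hψc : ContDiff ℝ 2 ψc) (hδψ : ContDiff ℝ 2 δψ)
    (hconv : ∀ x, lam0 ≤ deriv (deriv ψc) x) (hb1 : ∀ x, |deriv δψ x| ≤ B) :
    ∃ a A T : ℝ, 0 < a ∧ 0 < A ∧ 0 < T ∧ ∀ σ, ∃ x₀ τ, 0 < τ ∧ τ ≤ T ∧ ∀ α, |α| ≤ L →
      ∃ s, 0 < s ∧ IsUnitScale a A fun u => s * siteDensity ψ α σ (x₀ + τ * u) := by
  obtain ⟨a, A, ha, hA, hAll⟩ := exists_isUnitScale_exp_neg (D := (B + L) ^ 2 / lam0)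
    (E := (B + L) * √(2 / lam0)) (by positivity)
  refine ⟨a, A, √(2 / lam0), ha, hA, by positivity, fun σ => ?_⟩
  have hψd : Differentiable ℝ ψc := hψc.differentiable two_ne_zero
  have hδd : Differentiable ℝ δψ := hδψ.differentiable two_ne_zero
  have hψd2 : Differentiable ℝ (deriv ψc) := hψc.deriv'.differentiable one_ne_zero
  obtain ⟨x₀, hx₀⟩ : ∃ x₀, deriv ψc x₀ - σ = 0 := by
    have e : deriv (fun x => ψc x - σ * x) = fun x => deriv ψc x - σ := by
      ext x
      exact ((hψd x).hasDerivAt.sub ((hasDerivAt_id x).const_mul σ)).deriv.trans (by simp)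
    obtain ⟨x₀, hx₀⟩ := exists_deriv_eq_zero_of_le_deriv2 (h := fun x => ψc x - σ * x) hlam0
      (by fun_prop) (fun x => by rw [e, deriv_sub_const]; exact hconv x)
    rw [e] at hx₀
    exact ⟨x₀, hx₀⟩
  set r : ℝ → ℝ := fun t => ψc (x₀ + t) - ψc x₀ - σ * t with hr
  have hrd : ∀ t, HasDerivAt r (deriv ψc (x₀ + t) - σ) t := fun t => by
    have h1 : HasDerivAt (fun t => ψc (x₀ + t)) (deriv ψc (x₀ + t)) t :=
      HasDerivAt.comp_const_add x₀ t (hψd _).hasDerivAt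
    exact ((h1.sub_const _).sub ((hasDerivAt_id t).const_mul σ)).congr_deriv (by simp)
  have hr' : deriv r = fun t => deriv ψc (x₀ + t) - σ := funext fun t => (hrd t).deriv
  have hrC : ContDiff ℝ 2 r := by
    have : ContDiff ℝ 2 fun t => ψc (x₀ + t) := hψc.comp (by fun_prop)
    exact (this.sub contDiff_const).sub (by fun_prop)
  have hr2 : ∀ t, lam0 ≤ deriv (deriv r) t := fun t => by
    rw [hr', deriv_sub_const, deriv_comp_const_add]
    exact hconv _
  have hr0' : deriv r 0 = 0 := by rw [hr']; simpa using hx₀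
  have hr0 : r 0 = 0 := by simp [hr]
  obtain ⟨τ, hτ0, hτT, hgrow, b, hb⟩ := exists_well_scale hlam0 hrC hr2 hr0' hr0
  refine ⟨x₀, τ, hτ0, hτT, fun α hα => ⟨exp (-(σ * x₀ - (α * x₀ + ψ x₀))), exp_pos _, ?_⟩⟩
  set g : ℝ → ℝ := fun u => δψ (x₀ + τ * u) - δψ x₀ + α * (τ * u) with hg
  have haff : ∀ u, HasDerivAt (fun u => x₀ + τ * u) τ u := fun u =>
    (((hasDerivAt_id u).const_mul τ).const_add x₀).congr_deriv (by simp)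
  have hτu : ∀ u, HasDerivAt (fun u => τ * u) τ u := fun u =>
    ((hasDerivAt_id u).const_mul τ).congr_deriv (by simp)
  have hgd : ∀ u, HasDerivAt g ((deriv δψ (x₀ + τ * u) + α) * τ) u := fun u => by
    have h1 : HasDerivAt (fun u => δψ (x₀ + τ * u)) (deriv δψ (x₀ + τ * u) * τ) u :=
      HasDerivAt.comp u (hδd _).hasDerivAt (haff u)
    exact ((h1.sub_const _).add ((hτu u).const_mul α)).congr_deriv (by ring)
  have hBL : ∀ x, |deriv δψ x + α| ≤ B + L := fun x =>
    (abs_add_le _ _).trans (add_le_add (hb1 x) hα)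
  have hgE : ∀ u, |(deriv δψ (x₀ + τ * u) + α) * τ| ≤ (B + L) * τ := fun u => by
    rw [abs_mul, abs_of_pos hτ0]
    gcongr
    exact hBL _
  have hg1 : ∀ u, |g u| ≤ (B + L) * |τ * u| := fun u => by
    have := (convex_univ : Convex ℝ (Set.univ : Set ℝ)).norm_image_sub_le_of_norm_hasDerivWithin_le
      (f := g) (x := 0) (y := u) (fun x _ => (hgd x).hasDerivWithinAt) (fun x _ => hgE x)
      trivial trivial
    simp only [hg, mul_zero, add_zero, sub_self, sub_zero, Real.norm_eq_abs] at this
    rw [abs_mul, abs_of_pos hτ0, ← mul_assoc]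
    exact this
  have hBT : (B + L) * τ ≤ (B + L) * √(2 / lam0) := by gcongr
  have hfun : (fun u => exp (-(σ * x₀ - (α * x₀ + ψ x₀))) * siteDensity ψ α σ (x₀ + τ * u)) =
      fun u => exp (-(r (τ * u) + g u)) := by
    ext u
    rw [siteDensity, ← exp_add]
    congr 1
    simp only [hr, hg, hsplit]
    ring
  rw [hfun]
  have hδ' := hδψ.continuous_deriv one_le_two
  have hψ' := hψc.continuous_deriv one_le_two
  refine hAll (fun u => r (τ * u)) g (fun u => deriv r (τ * u) * τ) _
    (fun u => ?_) hgd (by rw [hr']; fun_prop) (by fun_prop) (fun u => ?_) (fun u hu => ?_)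
    (fun u hu => ?_) hgrow ⟨b, fun u hu => ⟨(hb u hu).2, ?_⟩⟩ (fun u => ?_)
    fun u => (hgE u).trans hBT
  · rw [hr']
    exact HasDerivAt.comp u (hrd _) (hτu u)
  · exact le_trans (by positivity) (well_ge hrC hr2 hr0' hr0 (τ * u))
  · exact mul_nonneg (le_trans (by positivity)
      (mul_le_deriv_of_well hrC hr2 hr0' (mul_nonneg hτ0.le hu))) hτ0.le
  · refine mul_nonpos_of_nonpos_of_nonneg ?_ hτ0.le
    have hu' := mul_nonpos_of_nonneg_of_nonpos hτ0.le hu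
    exact (deriv_le_mul_of_well hrC hr2 hr0' hu').trans
      (mul_nonpos_of_nonneg_of_nonpos hlam0.le hu')
  · refine (le_abs_self _).trans ((hg1 u).trans (le_trans ?_ hBT))
    rw [abs_mul, abs_of_pos hτ0]
    have : 0 ≤ (B + L) * τ := by positivity
    nlinarith [(hb u hu).1]
  · refine (hg1 u).trans ?_
    have h1 := well_ge hrC hr2 hr0' hr0 (τ * u)
    rw [← sq_abs] at h1
    set s := |τ * u|
    have h2 : (B + L) * s ≤ lam0 / 4 * s ^ 2 + (B + L) ^ 2 / lam0 := by
      have h3 : 0 ≤ (lam0 * s / 2 - (B + L)) ^ 2 / lam0 := by positivity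
      have h4 : (lam0 * s / 2 - (B + L)) ^ 2 / lam0 =
        lam0 / 4 * s ^ 2 - (B + L) * s + (B + L) ^ 2 / lam0 := by field_simp; ring
      linarith
    linarith

theorem integral_comp_add_mul {E : Type*} [NormedAddCommGroup E] [NormedSpace ℝ E] (G : ℝ → E)
    (x₀ : ℝ) {τ : ℝ} (hτ : 0 < τ) : ∫ u, G (x₀ + τ * u) = τ⁻¹ • ∫ x, G x := by
  rw [Measure.integral_comp_mul_left (fun y => G (x₀ + y)) τ, integral_add_left_eq_self,
    abs_of_pos (inv_pos.mpr hτ)]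

theorem integrable_comp_add_mul_iff {E : Type*} [NormedAddCommGroup E] [NormedSpace ℝ E]
    (G : ℝ → E) (x₀ : ℝ) {τ : ℝ} (hτ : τ ≠ 0) :
    Integrable (fun u => G (x₀ + τ * u)) ↔ Integrable G := by
  rw [integrable_comp_mul_left_iff (fun y => G (x₀ + y)) hτ]
  exact ⟨fun h => by simpa using h.comp_add_left (-x₀), fun h => h.comp_add_left x₀⟩

section Affine

variable {F f : ℝ → ℝ} {s x₀ τ : ℝ}

theorem densityMean_comp_affine (hs : s ≠ 0) (hτ : 0 < τ) (hf : ∀ u, f u = s * F (x₀ + τ * u))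
    (hi : Integrable f) (hi1 : Integrable fun u => u * f u) (hZ : ∫ u, f u ≠ 0) :
    densityMean F = x₀ + τ * densityMean f := by
  have h0 : ∫ u, f u = s * τ⁻¹ * ∫ x, F x := by
    simp_rw [hf]
    rw [integral_const_mul, integral_comp_add_mul F x₀ hτ, smul_eq_mul, mul_assoc]
  have h1 : x₀ * (∫ u, f u) + τ * ∫ u, u * f u = s * τ⁻¹ * ∫ x, x * F x := by
    calc _ = ∫ u, s * ((x₀ + τ * u) * F (x₀ + τ * u)) := by
          rw [← integral_const_mul, ← integral_const_mul,
            ← integral_add (hi.const_mul _) (hi1.const_mul _)]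
          congr 1; ext u
          rw [hf]; ring
      _ = _ := by
          rw [integral_const_mul, integral_comp_add_mul (fun x => x * F x) x₀ hτ, smul_eq_mul,
            mul_assoc]
  have hF : ∫ x, F x = (s * τ⁻¹)⁻¹ * ∫ u, f u := by rw [h0]; field_simp
  have hF1 : ∫ x, x * F x = (s * τ⁻¹)⁻¹ * (x₀ * (∫ u, f u) + τ * ∫ u, u * f u) := by
    rw [h1]; field_simp
  rw [densityMean, densityMean, hF, hF1]
  field_simp

theorem centeredChar_comp_affine (hs : s ≠ 0) (hτ : 0 < τ) (hf : ∀ u, f u = s * F (x₀ + τ * u))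
    (hi : Integrable f) (hi1 : Integrable fun u => u * f u) (hZ : ∫ u, f u ≠ 0) (ξ : ℝ) :
    centeredChar F ξ = centeredChar f (τ * ξ) := by
  have h0 : ∫ u, f u = s * τ⁻¹ * ∫ x, F x := by
    simp_rw [hf]
    rw [integral_const_mul, integral_comp_add_mul F x₀ hτ, smul_eq_mul, mul_assoc]
  have hF : ∫ x, F x = (s * τ⁻¹)⁻¹ * ∫ u, f u := by rw [h0]; field_simp
  have h1 : ∫ u, Complex.exp ((-2 * π * (u - densityMean f) * (τ * ξ) : ℝ) * Complex.I) * (f u : ℂ)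
      = (s * τ⁻¹ : ℝ) *
        ∫ x, Complex.exp ((-2 * π * (x - densityMean F) * ξ : ℝ) * Complex.I) * (F x : ℂ) := by
    calc _ = ∫ u, (s : ℂ) * (Complex.exp ((-2 * π * ((x₀ + τ * u) - densityMean F) * ξ : ℝ)
          * Complex.I) * (F (x₀ + τ * u) : ℂ)) := by
          congr 1; ext u
          rw [densityMean_comp_affine hs hτ hf hi hi1 hZ, hf]
          have : -2 * π * (u - densityMean f) * (τ * ξ) =
            -2 * π * (x₀ + τ * u - (x₀ + τ * densityMean f)) * ξ := by ring
          rw [this]; push_cast; ring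
      _ = _ := by
          rw [integral_const_mul, integral_comp_add_mul (fun x => Complex.exp
            ((-2 * π * (x - densityMean F) * ξ : ℝ) * Complex.I) * (F x : ℂ)) x₀ hτ,
            Complex.real_smul]
          push_cast; ring
  rw [centeredChar, centeredChar, h1, hF]
  have hs' : (s : ℂ) ≠ 0 := by exact_mod_cast hs
  have hτ' : (τ : ℂ) ≠ 0 := by exact_mod_cast hτ.ne'
  generalize (∫ x, Complex.exp ((-2 * π * (x - densityMean F) * ξ : ℝ) * Complex.I) * (F x : ℂ)) = w
  push_cast
  field_simp

end Affine

theorem IsUnitScale.integrable_id_mul {a A : ℝ} {f : ℝ → ℝ} (h : IsUnitScale a A f) :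
    Integrable fun x => x * f x :=
  h.integrable_mul continuous_id (B := 1) (j := 1) fun x => by simp

/-- The spectral second moment bound for products of characteristic functions of tilted
single-site densities. -/
theorem exists_siteDensity_second_moment_ge {ψ ψc δψ : ℝ → ℝ} {lam0 B L : ℝ}
    (hlam0 : 0 < lam0) (hB : 0 ≤ B) (hL : 0 < L)
    (hsplit : ∀ x, ψ x = ψc x + δψ x)
    (hψc : ContDiff ℝ 2 ψc) (hδψ : ContDiff ℝ 2 δψ)
    (hconv : ∀ x, lam0 ≤ deriv (deriv ψc) x) (hb1 : ∀ x, |deriv δψ x| ≤ B) :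
    ∃ (K₀ : ℕ) (κ : ℝ), 0 < κ ∧ 4 ≤ K₀ ∧ ∀ K, K₀ ≤ K → ∀ (α : Fin K → ℝ) (σ : ℝ),
      (∀ i, |α i| ≤ L) →
      Integrable (fun ξ => (1 + ξ ^ 2) * ‖∏ i, centeredChar (siteDensity ψ (α i) σ) ξ‖) ∧
      κ / K * ∫ ξ, ‖∏ i, centeredChar (siteDensity ψ (α i) σ) ξ‖ ≤
        ∫ ξ, ξ ^ 2 * (∏ i, centeredChar (siteDensity ψ (α i) σ) ξ).re := by
  obtain ⟨a, A, T, ha, hA, hT, hscale⟩ :=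
    exists_siteDensity_scale hlam0 hB hL hsplit hψc hδψ hconv hb1
  obtain ⟨c, C, hc, hC, hchar⟩ := exists_centeredChar_bounds ha hA
  obtain ⟨K₀, lam, hlam, hK₀, hprod⟩ := second_moment_prod_ge hc hC
  refine ⟨K₀, lam / T ^ 2, by positivity, hK₀, fun K hK α σ hα => ?_⟩
  obtain ⟨x₀, τ, hτ, hτT, hτs⟩ := hscale σ
  choose s hs hunit using fun i => hτs (α i) (hα i)
  set f : Fin K → ℝ → ℝ := fun i u => s i * siteDensity ψ (α i) σ (x₀ + τ * u) with hf
  have hunit' : ∀ i, IsUnitScale a A (f i) := hunit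
  have hb := fun i => hchar (f i) (hunit i)
  choose hb1 hb2 v hv1 hv2 hv3 using hb
  set φ : Fin K → ℝ → ℂ := fun i => centeredChar (f i) with hφ
  have hφc : ∀ i, Continuous (φ i) := fun i => (hunit' i).continuous_centeredChar
  have hcomp : ∀ i ξ, centeredChar (siteDensity ψ (α i) σ) ξ = φ i (τ * ξ) := fun i ξ =>
    centeredChar_comp_affine (hs i).ne' hτ (fun u => rfl) (hunit' i).integrable
      (hunit' i).integrable_id_mul (ha.trans_le (hunit' i).le_integral).ne' ξ
  simp only [hcomp]
  have h_int := integrable_norm_prod (hK₀.trans hK) hc hφc hb1 hb2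
  have hmain := hprod K hK φ v hφc hb1 hb2 hv1 hv2 hv3
  have hpc : Continuous fun ξ => ∏ i, φ i ξ := continuous_finsetProd _ fun i _ => hφc i
  constructor
  · have h1 := (integrable_comp_add_mul_iff _ 0 hτ.ne').mpr h_int
    simp only [zero_add] at h1
    refine (h1.const_mul (1 + 1 / τ ^ 2)).mono' (Continuous.aestronglyMeasurable ?_)
      (Filter.Eventually.of_forall fun ξ => ?_)
    · have := hpc.comp (continuous_const.mul continuous_id : Continuous fun ξ => τ * ξ)
      simp only [Function.comp_def] at this
      fun_prop
    · rw [Real.norm_of_nonneg (by positivity), ← mul_assoc]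
      gcongr
      have : (1 + 1 / τ ^ 2) * (1 + (τ * ξ) ^ 2) = 1 + ξ ^ 2 + (1 / τ ^ 2 + (τ * ξ) ^ 2) := by
        field_simp; ring
      rw [this]
      linarith [show 0 ≤ 1 / τ ^ 2 + (τ * ξ) ^ 2 by positivity]
  · have e1 : ∫ ξ, ‖∏ i, φ i (τ * ξ)‖ = τ⁻¹ * ∫ ξ, ‖∏ i, φ i ξ‖ := by
      simpa using integral_comp_add_mul (fun ξ => ‖∏ i, φ i ξ‖) 0 hτ
    have e2 : ∫ ξ, ξ ^ 2 * (∏ i, φ i (τ * ξ)).re =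
        (τ ^ 2)⁻¹ * (τ⁻¹ * ∫ ξ, ξ ^ 2 * (∏ i, φ i ξ).re) := by
      have := integral_comp_add_mul (fun ξ => ξ ^ 2 * (∏ i, φ i ξ).re) 0 hτ
      simp only [zero_add, smul_eq_mul] at this
      rw [← this, ← integral_const_mul]
      congr 1; ext ξ
      field_simp
    rw [e1, e2]
    have h0 : 0 ≤ ∫ ξ, ‖∏ i, φ i ξ‖ := integral_nonneg fun _ => norm_nonneg _
    calc _ = (T ^ 2)⁻¹ * (τ⁻¹ * (lam / K * ∫ ξ, ‖∏ i, φ i ξ‖)) := by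
          field_simp
      _ ≤ (τ ^ 2)⁻¹ * (τ⁻¹ * (lam / K * ∫ ξ, ‖∏ i, φ i ξ‖)) := by gcongr
      _ ≤ _ := by gcongr

theorem integral_pos_of_forall_pos {X : Type*} [MeasurableSpace X] {μ : Measure X} [NeZero μ]
    {g : X → ℝ} (h0 : ∀ x, 0 < g x) (hi : Integrable g μ) : 0 < ∫ x, g x ∂μ := by
  rw [integral_pos_iff_support_of_nonneg (fun x => (h0 x).le) hi]
  have : Function.support g = Set.univ := Set.eq_univ_of_forall fun x => (h0 x).ne'
  rw [this]
  exact Measure.measure_univ_pos.mpr (NeZero.ne μ)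

section ExpTilt

variable {w : ℝ → ℝ}

theorem abs_mul_exp_le (σ x : ℝ) : |x| * exp (σ * x) ≤ exp ((σ + 1) * x) + exp ((σ - 1) * x) := by
  have h1 : |x| ≤ exp x + exp (-x) := by
    have := add_one_le_exp x
    have := add_one_le_exp (-x)
    have := exp_pos x
    have := exp_pos (-x)
    exact abs_le.mpr ⟨by linarith, by linarith⟩
  have h2 : exp ((σ + 1) * x) + exp ((σ - 1) * x) = (exp x + exp (-x)) * exp (σ * x) := by
    rw [add_mul (exp x), ← exp_add, ← exp_add]; congr 2 <;> ring
  rw [h2]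
  gcongr

theorem integrable_id_mul_exp_mul (hw : Continuous w) (hw0 : ∀ x, 0 < w x)
    (hi : ∀ σ : ℝ, Integrable fun x => exp (σ * x) * w x) (σ : ℝ) :
    Integrable fun x => x * (exp (σ * x) * w x) := by
  refine ((hi (σ + 1)).add (hi (σ - 1))).mono' (Continuous.aestronglyMeasurable (by fun_prop))
    (Filter.Eventually.of_forall fun x => ?_)
  rw [norm_mul, Real.norm_of_nonneg (mul_nonneg (exp_pos _).le (hw0 x).le), Real.norm_eq_abs,
    ← mul_assoc, Pi.add_apply, ← add_mul]
  exact mul_le_mul_of_nonneg_right (abs_mul_exp_le σ x) (hw0 x).le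

theorem hasDerivAt_integral_exp_mul (hw : Continuous w) (hw0 : ∀ x, 0 < w x)
    (hi : ∀ σ : ℝ, Integrable fun x => exp (σ * x) * w x) (σ : ℝ) :
    HasDerivAt (fun σ => ∫ x, exp (σ * x) * w x) (∫ x, x * (exp (σ * x) * w x)) σ := by
  refine (hasDerivAt_integral_of_dominated_loc_of_deriv_le
    (bound := fun x => |x| * (exp ((σ + 1) * x) * w x) + |x| * (exp ((σ - 1) * x) * w x))
    (F' := fun σ x => x * (exp (σ * x) * w x))
    (Metric.ball_mem_nhds σ one_pos)
    (Filter.Eventually.of_forall fun σ => Continuous.aestronglyMeasurable (by fun_prop))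
    (hi σ) (Continuous.aestronglyMeasurable (by fun_prop))
    (Filter.Eventually.of_forall fun x t ht => ?_) ?_
    (Filter.Eventually.of_forall fun x t ht => ?_)).2
  · rw [Metric.mem_ball, Real.dist_eq, abs_lt] at ht
    rw [norm_mul, Real.norm_of_nonneg (mul_nonneg (exp_pos _).le (hw0 x).le), Real.norm_eq_abs,
      ← mul_add, ← add_mul]
    have h1 := exp_pos ((σ + 1) * x)
    have h2 := exp_pos ((σ - 1) * x)
    have h3 : exp (t * x) ≤ exp ((σ + 1) * x) + exp ((σ - 1) * x) := by
      rcases le_total 0 x with hx | hx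
      · have : exp (t * x) ≤ exp ((σ + 1) * x) := exp_le_exp.mpr (by nlinarith)
        linarith
      · have : exp (t * x) ≤ exp ((σ - 1) * x) := exp_le_exp.mpr (by nlinarith)
        linarith
    exact mul_le_mul_of_nonneg_left (mul_le_mul_of_nonneg_right h3 (hw0 x).le) (abs_nonneg x)
  · have h : ∀ σ : ℝ, Integrable fun x => |x| * (exp (σ * x) * w x) := fun σ =>
      (integrable_id_mul_exp_mul hw hw0 hi σ).abs.congr (Filter.Eventually.of_forall fun x => by
        simp only [abs_mul, abs_of_pos (exp_pos _), abs_of_pos (hw0 x)])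
    exact (h _).add (h _)
  · exact ((((hasDerivAt_id t).mul_const x).exp).mul_const (w x)).congr_deriv (by simp; ring)

theorem integral_exp_mul_pos (hw0 : ∀ x, 0 < w x)
    (hi : ∀ σ : ℝ, Integrable fun x => exp (σ * x) * w x) (σ : ℝ) :
    0 < ∫ x, exp (σ * x) * w x :=
  integral_pos_of_forall_pos (fun x => mul_pos (exp_pos _) (hw0 x)) (hi σ)

theorem exists_log_integral_exp_mul_ge (hw : Continuous w) (hw0 : ∀ x, 0 < w x)
    (hi : ∀ σ : ℝ, Integrable fun x => exp (σ * x) * w x) (p : ℝ) :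
    ∃ c, ∀ σ, |σ| + c ≤ log (∫ x, exp (σ * x) * w x) - σ * p := by
  have key : ∀ b σ ρ : ℝ, (∀ x ∈ Set.Icc b (b + 1), ρ ≤ σ * x) →
      ρ + log (∫ x in b..(b + 1), w x) ≤ log (∫ x, exp (σ * x) * w x) := by
    intro b σ ρ hρ
    have hI : 0 < ∫ x in b..(b + 1), w x :=
      intervalIntegral.intervalIntegral_pos_of_pos (hw.intervalIntegrable _ _) hw0 (by linarith)
    rw [← log_exp ρ, ← log_mul (exp_pos ρ).ne' hI.ne']
    refine log_le_log (by positivity) ?_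
    rw [intervalIntegral.integral_of_le (by linarith), ← integral_const_mul]
    calc _ ≤ ∫ x in Set.Ioc b (b + 1), exp (σ * x) * w x := by
          refine setIntegral_mono_on (Continuous.integrableOn_Ioc (by fun_prop))
            (hi σ).integrableOn measurableSet_Ioc fun x hx => ?_
          exact mul_le_mul_of_nonneg_right (exp_le_exp.mpr (hρ x ⟨hx.1.le, hx.2⟩)) (hw0 x).le
      _ ≤ _ := setIntegral_le_integral (hi σ) (Filter.Eventually.of_forall fun x =>
          mul_nonneg (exp_pos _).le (hw0 x).le)
  refine ⟨min (log (∫ x in (p + 1)..(p + 1 + 1), w x)) (log (∫ x in (p - 2)..(p - 2 + 1), w x)),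
    fun σ => ?_⟩
  rcases abs_cases σ with ⟨h, h'⟩ | ⟨h, h'⟩
  · have := key (p + 1) σ (σ * p + σ) fun x hx => by nlinarith [hx.1]
    have := min_le_left (log (∫ x in (p + 1)..(p + 1 + 1), w x))
      (log (∫ x in (p - 2)..(p - 2 + 1), w x))
    linarith
  · have := key (p - 2) σ (σ * p - σ) fun x hx => by nlinarith [hx.2]
    have := min_le_right (log (∫ x in (p + 1)..(p + 1 + 1), w x))
      (log (∫ x in (p - 2)..(p - 2 + 1), w x))
    linarith

end ExpTilt

/-- Exponential tilting attains any prescribed total mean. -/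
theorem exists_sum_densityMean_eq {K : ℕ} (hK : 0 < K) {w : Fin K → ℝ → ℝ}
    (hw : ∀ i, Continuous (w i)) (hw0 : ∀ i x, 0 < w i x)
    (hi : ∀ i (σ : ℝ), Integrable fun x => exp (σ * x) * w i x) (s : ℝ) :
    ∃ σ, ∑ i, densityMean (fun x => exp (σ * x) * w i x) = s := by
  set p := s / K with hp
  have hK' : (0 : ℝ) < K := by exact_mod_cast hK
  set G : ℝ → ℝ := fun σ => ∑ i, (log (∫ x, exp (σ * x) * w i x) - σ * p) with hG
  have hd : ∀ σ, HasDerivAt G (∑ i, (densityMean (fun x => exp (σ * x) * w i x) - p)) σ :=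
    fun σ => HasDerivAt.fun_sum fun i _ =>
      (((hasDerivAt_integral_exp_mul (hw i) (hw0 i) (hi i) σ).log
        (integral_exp_mul_pos (hw0 i) (hi i) σ).ne').sub
        ((hasDerivAt_id σ).mul_const p)).congr_deriv (by simp [densityMean])
  have hGc : Continuous G := continuous_iff_continuousAt.mpr fun σ => (hd σ).continuousAt
  choose c hc using fun i => exists_log_integral_exp_mul_ge (hw i) (hw0 i) (hi i) p
  have hlim : Filter.Tendsto G (Filter.cocompact ℝ) Filter.atTop := by
    refine Filter.tendsto_atTop_mono (f := fun σ => K * |σ| + ∑ i, c i) (fun σ => ?_) ?_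
    · calc _ = ∑ i, (|σ| + c i) := by simp [Finset.sum_add_distrib]
        _ ≤ _ := Finset.sum_le_sum fun i _ => hc i σ
    · exact Filter.tendsto_atTop_add_const_right _ _
        ((tendsto_norm_cocompact_atTop (E := ℝ)).const_mul_atTop hK')
  obtain ⟨σ, hσ⟩ := hGc.exists_forall_le hlim
  refine ⟨σ, ?_⟩
  have h0 : deriv G σ = 0 :=
    IsLocalMin.deriv_eq_zero (Filter.Eventually.of_forall fun t => hσ t)
  rw [(hd σ).deriv, Finset.sum_sub_distrib] at h0
  simp only [Finset.sum_const, Finset.card_univ, Fintype.card_fin, nsmul_eq_mul, hp] at h0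
  rw [mul_div_cancel₀ _ hK'.ne'] at h0
  linarith

/-- The unnormalized density of the sum of independent variables with densities `f i`. -/
def convDensity {n : ℕ} (f : Fin (n + 1) → ℝ → ℝ) (s : ℝ) : ℝ :=
  ∫ y : Fin n → ℝ, (∏ i, f i.castSucc (y i)) * f (Fin.last n) (s - ∑ i, y i)

section ConvDensity

variable {n : ℕ} {f : Fin (n + 1) → ℝ → ℝ}

theorem integrable_prod_castSucc (hi : ∀ i, Integrable (f i)) :
    Integrable fun y : Fin n → ℝ => ∏ i, f i.castSucc (y i) :=
  Integrable.fintype_prod (f := fun i : Fin n => f i.castSucc) fun _ => hi _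

theorem integrable_convDensity_integrand (hc : ∀ i, Continuous (f i)) (h0 : ∀ i x, 0 < f i x)
    (hi : ∀ i, Integrable (f i)) {C : ℝ} (hb : ∀ i x, f i x ≤ C) (s : ℝ) :
    Integrable fun y : Fin n → ℝ =>
      (∏ i, f i.castSucc (y i)) * f (Fin.last n) (s - ∑ i, y i) := by
  refine ((integrable_prod_castSucc hi).mul_const C).mono'
    (Continuous.aestronglyMeasurable (by fun_prop)) (Filter.Eventually.of_forall fun y => ?_)
  have hp : 0 ≤ ∏ i, f i.castSucc (y i) := Finset.prod_nonneg fun i _ => (h0 _ _).le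
  rw [Real.norm_of_nonneg (mul_nonneg hp (h0 _ _).le)]
  exact mul_le_mul_of_nonneg_left (hb _ _) hp

theorem continuous_convDensity (hc : ∀ i, Continuous (f i)) (h0 : ∀ i x, 0 < f i x)
    (hi : ∀ i, Integrable (f i)) {C : ℝ} (hb : ∀ i x, f i x ≤ C) :
    Continuous (convDensity f) := by
  refine continuous_of_dominated (bound := fun y : Fin n → ℝ => (∏ i, f i.castSucc (y i)) * C)
    (fun s => Continuous.aestronglyMeasurable (by fun_prop))
    (fun s => Filter.Eventually.of_forall fun y => ?_)
    ((integrable_prod_castSucc hi).mul_const C)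
    (Filter.Eventually.of_forall fun y => by fun_prop)
  have hp : 0 ≤ ∏ i, f i.castSucc (y i) := Finset.prod_nonneg fun i _ => (h0 _ _).le
  rw [Real.norm_of_nonneg (mul_nonneg hp (h0 _ _).le)]
  exact mul_le_mul_of_nonneg_left (hb _ _) hp

theorem convDensity_pos (hc : ∀ i, Continuous (f i)) (h0 : ∀ i x, 0 < f i x)
    (hi : ∀ i, Integrable (f i)) {C : ℝ} (hb : ∀ i x, f i x ≤ C) (s : ℝ) :
    0 < convDensity f s :=
  integral_pos_of_forall_pos
    (fun _ => mul_pos (Finset.prod_pos fun _ _ => h0 _ _) (h0 _ _))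
    (integrable_convDensity_integrand hc h0 hi hb s)

theorem integrable_convDensity_uncurry (hc : ∀ i, Continuous (f i)) (h0 : ∀ i x, 0 < f i x)
    (hi : ∀ i, Integrable (f i)) :
    Integrable (fun p : (Fin n → ℝ) × ℝ =>
      (∏ i, f i.castSucc (p.1 i)) * f (Fin.last n) (p.2 - ∑ i, p.1 i))
      ((volume : Measure (Fin n → ℝ)).prod volume) := by
  rw [integrable_prod_iff (Continuous.aestronglyMeasurable (by fun_prop))]
  refine ⟨Filter.Eventually.of_forall fun y =>
    ((hi (Fin.last n)).comp_sub_right (∑ i, y i)).const_mul (∏ i, f i.castSucc (y i)), ?_⟩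
  refine ((integrable_prod_castSucc hi).mul_const (∫ x, f (Fin.last n) x)).congr
    (Filter.Eventually.of_forall fun y => ?_)
  have hp : 0 ≤ ∏ i, f i.castSucc (y i) := Finset.prod_nonneg fun i _ => (h0 _ _).le
  simp only
  rw [← integral_sub_right_eq_self _ (∑ i, y i), ← integral_const_mul]
  refine integral_congr_ae (Filter.Eventually.of_forall fun s => ?_)
  simp only
  rw [Real.norm_of_nonneg (mul_nonneg hp (h0 _ _).le)]

theorem integrable_convDensity (hc : ∀ i, Continuous (f i)) (h0 : ∀ i x, 0 < f i x)
    (hi : ∀ i, Integrable (f i)) : Integrable (convDensity f) :=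
  (integrable_convDensity_uncurry hc h0 hi).integral_prod_right

theorem fourier_convDensity (hc : ∀ i, Continuous (f i)) (h0 : ∀ i x, 0 < f i x)
    (hi : ∀ i, Integrable (f i)) (ξ : ℝ) :
    ∫ s, Complex.exp ((-2 * π * s * ξ : ℝ) * Complex.I) * (convDensity f s : ℂ) =
      ∏ i, ∫ x, Complex.exp ((-2 * π * x * ξ : ℝ) * Complex.I) * (f i x : ℂ) := by
  set g : Fin (n + 1) → ℝ → ℂ := fun i x =>
    Complex.exp ((-2 * π * x * ξ : ℝ) * Complex.I) * (f i x : ℂ) with hg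
  have h_int : Integrable (fun p : (Fin n → ℝ) × ℝ => Complex.exp ((-2 * π * p.2 * ξ : ℝ) * Complex.I)
      * (((∏ i, f i.castSucc (p.1 i)) * f (Fin.last n) (p.2 - ∑ i, p.1 i) : ℝ) : ℂ))
      ((volume : Measure (Fin n → ℝ)).prod volume) := by
    refine (integrable_convDensity_uncurry hc h0 hi).mono'
      (Continuous.aestronglyMeasurable (by fun_prop)) (Filter.Eventually.of_forall fun p => ?_)
    rw [norm_mul, Complex.norm_exp_ofReal_mul_I, one_mul, Complex.norm_real, Real.norm_of_nonneg
      (mul_nonneg (Finset.prod_nonneg fun i _ => (h0 _ _).le) (h0 _ _).le)]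
  calc _ = ∫ s, ∫ y : Fin n → ℝ, Complex.exp ((-2 * π * s * ξ : ℝ) * Complex.I)
      * (((∏ i, f i.castSucc (y i)) * f (Fin.last n) (s - ∑ i, y i) : ℝ) : ℂ) := by
        congr 1; ext s
        rw [convDensity, ← integral_complex_ofReal, integral_const_mul]
    _ = ∫ y : Fin n → ℝ, ∫ s, Complex.exp ((-2 * π * s * ξ : ℝ) * Complex.I)
      * (((∏ i, f i.castSucc (y i)) * f (Fin.last n) (s - ∑ i, y i) : ℝ) : ℂ) :=
        (integral_integral_swap h_int).symm
    _ = ∫ y : Fin n → ℝ, (∏ i, g i.castSucc (y i)) * ∫ x, g (Fin.last n) x := by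
        congr 1; ext y
        rw [← integral_sub_right_eq_self (g (Fin.last n)) (∑ i, y i), ← integral_const_mul]
        congr 1; ext s
        simp only [hg, Finset.prod_mul_distrib, ← Complex.exp_sum]
        have : (((-2 * π * s * ξ : ℝ) : ℂ) * Complex.I) =
            (∑ i, ((-2 * π * y i * ξ : ℝ) : ℂ) * Complex.I) +
              ((-2 * π * (s - ∑ i, y i) * ξ : ℝ) : ℂ) * Complex.I := by
          rw [← Finset.sum_mul, ← Complex.ofReal_sum, ← Finset.sum_mul, ← Finset.mul_sum]
          push_cast; ring
        rw [this, Complex.exp_add]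
        push_cast; ring
    _ = _ := by
        rw [integral_mul_const, Fin.prod_univ_castSucc,
          integral_fintype_prod_volume_eq_prod (fun i => g (Fin.castSucc i))]

end ConvDensity

theorem fourier_density_eq_centeredChar {f : ℝ → ℝ} (hZ : ∫ x, f x ≠ 0) (ξ : ℝ) :
    ∫ x, Complex.exp ((-2 * π * x * ξ : ℝ) * Complex.I) * (f x : ℂ) =
      ((∫ x, f x : ℝ) : ℂ) * Complex.exp ((-2 * π * densityMean f * ξ : ℝ) * Complex.I) *
        centeredChar f ξ := by
  have hZ' : ((∫ x, f x : ℝ) : ℂ) ≠ 0 := by exact_mod_cast hZ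
  rw [centeredChar, mul_assoc, mul_left_comm (Complex.exp _), mul_inv_cancel_left₀ hZ',
    ← integral_const_mul]
  congr 1; ext x
  rw [← mul_assoc, ← Complex.exp_add]
  congr 2; push_cast; ring

section ConvDensity

open FourierTransform

variable {n : ℕ} {f : Fin (n + 1) → ℝ → ℝ}

/-- Smoothness of the density of a sum, and its value and second derivative at the mean in
terms of the centered characteristic functions. -/
theorem convDensity_at_mean (hc : ∀ i, Continuous (f i)) (h0 : ∀ i x, 0 < f i x)
    (hi : ∀ i, Integrable (f i)) {C : ℝ} (hb : ∀ i x, f i x ≤ C)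
    (hχ : Integrable fun ξ => (1 + ξ ^ 2) * ‖∏ i, centeredChar (f i) ξ‖)
    (hχc : Continuous fun ξ => ∏ i, centeredChar (f i) ξ) :
    ContDiff ℝ 2 (convDensity f) ∧
      convDensity f (∑ i, densityMean (f i)) =
        (∏ i, ∫ x, f i x) * ∫ ξ, (∏ i, centeredChar (f i) ξ).re ∧
      deriv (deriv (convDensity f)) (∑ i, densityMean (f i)) =
        -(4 * π ^ 2) * (∏ i, ∫ x, f i x) * ∫ ξ, ξ ^ 2 * (∏ i, centeredChar (f i) ξ).re := by
  set χ : ℝ → ℂ := fun ξ => ∏ i, centeredChar (f i) ξ with hχdef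
  set Z := ∏ i, ∫ x, f i x with hZ
  set s₀ := ∑ i, densityMean (f i) with hs₀
  have hZi : ∀ i, ∫ x, f i x ≠ 0 := fun i =>
    (integral_pos_of_forall_pos (h0 i) (hi i)).ne'
  set p : ℝ → ℂ := fun s => (convDensity f s : ℂ) with hp
  have hpc : Continuous p := Complex.continuous_ofReal.comp (continuous_convDensity hc h0 hi hb)
  have hpi : Integrable p := (integrable_convDensity hc h0 hi).ofReal
  have hF : 𝓕 p = fun ξ => (Z : ℂ) * Complex.exp ((-2 * π * s₀ * ξ : ℝ) * Complex.I) * χ ξ := by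
    ext ξ
    rw [fourier_real_eq_integral_exp_smul]
    simp only [smul_eq_mul, hp]
    rw [fourier_convDensity hc h0 hi]
    simp only [fourier_density_eq_centeredChar (hZi _), Finset.prod_mul_distrib,
      ← Complex.exp_sum]
    rw [hZ, hs₀, Complex.ofReal_prod, ← Finset.sum_mul, ← Complex.ofReal_sum, ← Finset.sum_mul,
      ← Finset.mul_sum]
  have hmeas : AEStronglyMeasurable χ := hχc.aestronglyMeasurable
  have hχn : ∀ k : ℕ, k ≤ 2 → Integrable fun ξ : ℝ => ξ ^ k • χ ξ := fun k hk => by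
    refine hχ.mono' ((by fun_prop : Continuous fun ξ : ℝ => ξ ^ k).aestronglyMeasurable.smul hmeas)
      (Filter.Eventually.of_forall fun ξ => ?_)
    rw [norm_smul, norm_pow, Real.norm_eq_abs]
    refine mul_le_mul_of_nonneg_right ?_ (norm_nonneg _)
    rw [← sq_abs]
    have := abs_nonneg ξ
    interval_cases k <;> nlinarith [sq_nonneg (|ξ| - 1)]
  set q : ℝ → ℂ := fun ξ => (Z : ℂ) * Complex.exp ((2 * π * s₀ * ξ : ℝ) * Complex.I) * χ (-ξ)
    with hq
  have hpq : p = 𝓕 q := by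
    have hFi : Integrable (𝓕 p) := by
      rw [hF]
      refine ((hχn 0 (by norm_num)).norm.const_mul ‖(Z : ℂ)‖).mono'
        (Continuous.aestronglyMeasurable (by fun_prop)) (Filter.Eventually.of_forall fun ξ => ?_)
      rw [norm_mul, norm_mul, Complex.norm_exp_ofReal_mul_I, mul_one, pow_zero, one_smul]
    rw [← hpc.fourierInv_fourier_eq hpi hFi, fourierInv_eq_fourier_comp_neg, hF]
    congr 1; ext ξ
    simp only [hq]
    congr 3; push_cast; ring
  have hqn : ∀ k : ℕ, k ≤ 2 → Integrable fun ξ : ℝ => ξ ^ k • q ξ := fun k hk => by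
    have h1 := ((hχn k hk).comp_neg.norm.const_mul ‖(Z : ℂ)‖)
    refine h1.mono' (Continuous.aestronglyMeasurable (by fun_prop))
      (Filter.Eventually.of_forall fun ξ => le_of_eq ?_)
    simp only [hq, norm_smul, norm_mul, Complex.norm_exp_ofReal_mul_I, norm_pow, norm_neg]
    ring
  have hq' : ∀ k : ℕ, (k : ℕ∞) ≤ (2 : ℕ∞) → Integrable fun ξ : ℝ => ‖ξ‖ ^ k * ‖q ξ‖ :=
    fun k hk => (hqn k (by exact_mod_cast hk)).norm.congr
      (Filter.Eventually.of_forall fun ξ => by simp)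
  have hpC : ContDiff ℝ 2 p := by
    rw [hpq]
    exact contDiff_fourier (N := 2) hq'
  have hre : convDensity f = fun s => (p s).re := funext fun s => by simp [hp]
  have hcd : ContDiff ℝ 2 (convDensity f) := by
    rw [hre]
    exact Complex.reCLM.contDiff.comp hpC
  have hexp : ∀ ξ : ℝ, Complex.exp ((-2 * π * ξ * s₀ : ℝ) * Complex.I) *
      Complex.exp ((2 * π * s₀ * ξ : ℝ) * Complex.I) = 1 := fun ξ => by
    rw [← Complex.exp_add, ← Complex.exp_zero]
    congr 1; push_cast; ring
  have hval : p s₀ = (Z : ℂ) * ∫ ξ, χ ξ := by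
    rw [hpq, fourier_real_eq_integral_exp_smul, ← integral_neg_eq_self χ, ← integral_const_mul]
    congr 1; ext ξ
    simp only [hq, smul_eq_mul]
    linear_combination (Z * χ (-ξ)) * hexp ξ
  have hval2 : iteratedDeriv 2 p s₀ = ((-(4 * π ^ 2) * Z : ℝ) : ℂ) * ∫ ξ : ℝ, ξ ^ 2 • χ ξ := by
    rw [hpq, iteratedDeriv_fourier (N := 2) (fun k hk => hqn k (by exact_mod_cast hk)) le_rfl,
      fourier_real_eq_integral_exp_smul,
      ← integral_neg_eq_self (fun ξ : ℝ => ξ ^ 2 • χ ξ), ← integral_const_mul]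
    congr 1; ext ξ
    simp only [hq, smul_eq_mul, Complex.real_smul]
    push_cast
    have h1 := hexp ξ
    push_cast at h1
    linear_combination (-(4 * π ^ 2) * Z * ξ ^ 2 * χ (-ξ)) * h1 +
      (4 * π ^ 2 * ξ ^ 2 * (Complex.exp (-2 * π * ξ * s₀ * Complex.I)
        * Complex.exp (2 * π * s₀ * ξ * Complex.I)) * Z * χ (-ξ)) * Complex.I_sq
  have hd1 : deriv p = fun s => ((deriv (convDensity f) s : ℝ) : ℂ) := funext fun s =>
    (((hcd.differentiable two_ne_zero) s).hasDerivAt.ofReal_comp).deriv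
  have hd2 : iteratedDeriv 2 p s₀ = ((deriv (deriv (convDensity f)) s₀ : ℝ) : ℂ) := by
    rw [iteratedDeriv_succ, iteratedDeriv_one, hd1]
    exact (((hcd.deriv'.differentiable one_ne_zero) s₀).hasDerivAt.ofReal_comp).deriv
  refine ⟨hcd, ?_, ?_⟩
  · rw [hre]
    simp only
    rw [hval, Complex.re_ofReal_mul, ← RCLike.re_eq_complex_re, ← integral_re
      (by simpa using hχn 0 (by norm_num))]
  · have := congrArg Complex.re (hd2.symm.trans hval2)
    rw [Complex.ofReal_re, Complex.re_ofReal_mul, ← RCLike.re_eq_complex_re,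
      ← integral_re (hχn 2 le_rfl)] at this
    rw [this]
    congr 2; ext ξ
    rw [RCLike.re_eq_complex_re, Complex.real_smul, Complex.re_ofReal_mul]

end ConvDensity

theorem siteDensity_pos (ψ : ℝ → ℝ) (α σ x : ℝ) : 0 < siteDensity ψ α σ x := exp_pos _

theorem siteDensity_eq_exp_mul (ψ : ℝ → ℝ) (α σ x : ℝ) :
    siteDensity ψ α σ x = exp (σ * x) * siteDensity ψ α 0 x := by
  rw [siteDensity, siteDensity, ← exp_add]
  congr 1; ring

theorem convDensity_siteDensity {n : ℕ} (ψ : ℝ → ℝ) (α : Fin (n + 1) → ℝ) (σ s : ℝ) :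
    convDensity (fun i => siteDensity ψ (α i) σ) s =
      exp (σ * s) * convDensity (fun i => siteDensity ψ (α i) 0) s := by
  rw [convDensity, convDensity, ← integral_const_mul]
  congr 1; ext y
  simp only [siteDensity_eq_exp_mul ψ _ σ, Finset.prod_mul_distrib, ← exp_sum, ← Finset.mul_sum]
  have : exp (σ * s) = exp (σ * ∑ i, y i) * exp (σ * (s - ∑ i, y i)) := by
    rw [← exp_add]; congr 1; ring
  rw [this]; ring

theorem IsUnitScale.le_upper {a A : ℝ} {f : ℝ → ℝ} (h : IsUnitScale a A f) (x : ℝ) : f x ≤ A := by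
  refine (h.le_exp x).trans (mul_le_of_le_one_right h.upper_nonneg (exp_le_one_iff.mpr ?_))
  linarith [abs_nonneg x]

theorem siteDensity_regular {ψ ψc δψ : ℝ → ℝ} {lam0 B L : ℝ}
    (hlam0 : 0 < lam0) (hB : 0 ≤ B) (hL : 0 < L)
    (hsplit : ∀ x, ψ x = ψc x + δψ x)
    (hψc : ContDiff ℝ 2 ψc) (hδψ : ContDiff ℝ 2 δψ)
    (hconv : ∀ x, lam0 ≤ deriv (deriv ψc) x) (hb1 : ∀ x, |deriv δψ x| ≤ B)
    {α : ℝ} (hα : |α| ≤ L) (σ : ℝ) :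
    Integrable (siteDensity ψ α σ) ∧ (∃ C, ∀ x, siteDensity ψ α σ x ≤ C) ∧
      Continuous (centeredChar (siteDensity ψ α σ)) := by
  obtain ⟨a, A, T, ha, hA, hT, h⟩ :=
    exists_siteDensity_scale hlam0 hB hL hsplit hψc hδψ hconv hb1
  obtain ⟨x₀, τ, hτ, -, h⟩ := h σ
  obtain ⟨s, hs, hu⟩ := h α hα
  refine ⟨?_, ⟨s⁻¹ * A, fun x => ?_⟩, ?_⟩
  · rw [← integrable_comp_add_mul_iff _ x₀ hτ.ne']
    refine (hu.integrable.const_mul s⁻¹).congr (Filter.Eventually.of_forall fun u => ?_)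
    exact inv_mul_cancel_left₀ hs.ne' _
  · have := hu.le_upper (τ⁻¹ * (x - x₀))
    rw [mul_inv_cancel_left₀ hτ.ne', add_sub_cancel] at this
    rwa [← inv_mul_le_iff₀ (inv_pos.mpr hs), inv_inv]
  · have : centeredChar (siteDensity ψ α σ) = fun ξ =>
        centeredChar (fun u => s * siteDensity ψ α σ (x₀ + τ * u)) (τ * ξ) :=
      funext fun ξ => centeredChar_comp_affine hs.ne' hτ (fun u => rfl) hu.integrable
        hu.integrable_id_mul (ha.trans_le hu.le_integral).ne' ξ
    rw [this]
    exact hu.continuous_centeredChar.comp (by fun_prop)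

theorem deriv2_log_le_of_exp_tilt {P Q : ℝ → ℝ} {σ q s : ℝ} (hP : ∀ x, 0 < P x)
    (hPC : ContDiff ℝ 2 P) (hQ : ∀ x, Q x = exp (σ * x) * P x)
    (h : deriv (deriv Q) s ≤ -q * Q s) :
    deriv (deriv fun x => log (P x)) s ≤ -q := by
  have hQ0 : ∀ x, 0 < Q x := fun x => by rw [hQ]; exact mul_pos (exp_pos _) (hP x)
  have hQC : ContDiff ℝ 2 Q := by
    rw [funext hQ]; fun_prop
  have hQd : Differentiable ℝ Q := hQC.differentiable (by norm_num)
  have hQd' : Differentiable ℝ (deriv Q) :=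
    ((contDiff_succ_iff_deriv (n := 1)).1 hQC).2.2.differentiable (by norm_num)
  have h1 : deriv (fun x => log (P x)) = fun x => deriv Q x / Q x - σ := by
    ext x
    have : (fun x => log (P x)) = fun x => log (Q x) - σ * x := by
      ext x
      rw [hQ, log_mul (exp_pos _).ne' (hP x).ne', log_exp]; ring
    rw [this]
    have hid : HasDerivAt (fun x => σ * x) σ x := by
      simpa using (hasDerivAt_id x).const_mul σ
    exact (((hQd x).hasDerivAt.log (hQ0 x).ne').sub hid).deriv
  have h2 : deriv (fun x => deriv Q x / Q x - σ) s = _ :=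
    (((hQd' s).hasDerivAt.div (hQd s).hasDerivAt (hQ0 s).ne').sub_const σ).deriv
  rw [h1, h2, div_le_iff₀ (pow_pos (hQ0 s) 2)]
  nlinarith [mul_le_mul_of_nonneg_right h (hQ0 s).le, sq_nonneg (deriv Q s)]

/-- The density of a sum of many sites is uniformly log-concave. -/
theorem exists_log_convDensity_deriv2_le {ψ ψc δψ : ℝ → ℝ} {lam0 B L : ℝ}
    (hlam0 : 0 < lam0) (hB : 0 ≤ B) (hL : 0 < L)
    (hsplit : ∀ x, ψ x = ψc x + δψ x)
    (hψc : ContDiff ℝ 2 ψc) (hδψ : ContDiff ℝ 2 δψ)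
    (hconv : ∀ x, lam0 ≤ deriv (deriv ψc) x) (hb1 : ∀ x, |deriv δψ x| ≤ B) :
    ∃ (K₀ : ℕ) (c : ℝ), 0 < c ∧ 0 < K₀ ∧ ∀ n : ℕ, K₀ ≤ n + 1 → ∀ α : Fin (n + 1) → ℝ,
      (∀ i, |α i| ≤ L) →
      ContDiff ℝ 2 (convDensity fun i => siteDensity ψ (α i) 0) ∧
      (∀ s, 0 < convDensity (fun i => siteDensity ψ (α i) 0) s) ∧
      ∀ s, deriv (deriv fun s => log (convDensity (fun i => siteDensity ψ (α i) 0) s)) s ≤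
        -(c / (n + 1 : ℕ)) := by
  obtain ⟨K₀, κ, hκ, hK₀, h⟩ :=
    exists_siteDensity_second_moment_ge hlam0 hB hL hsplit hψc hδψ hconv hb1
  refine ⟨K₀, 4 * π ^ 2 * κ, by positivity, by omega, fun n hn α hα => ?_⟩
  have hψ : Continuous ψ := by
    rw [funext hsplit]; exact hψc.continuous.add hδψ.continuous
  have hreg := fun i σ =>
    siteDensity_regular hlam0 hB hL hsplit hψc hδψ hconv hb1 (hα i) σ
  have hc : ∀ σ i, Continuous (siteDensity ψ (α i) σ) := fun σ i => by
    unfold siteDensity; fun_prop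
  have h0 : ∀ σ i x, 0 < siteDensity ψ (α i) σ x := fun σ i x => siteDensity_pos _ _ _ _
  have hb : ∀ σ, ∃ C, ∀ i x, siteDensity ψ (α i) σ x ≤ C := fun σ => by
    choose C hC using fun i => (hreg i σ).2.1
    obtain ⟨M, hM⟩ := (Set.finite_range C).bddAbove
    exact ⟨M, fun i x => (hC i x).trans (hM ⟨i, rfl⟩)⟩
  have hχc : ∀ σ, Continuous fun ξ => ∏ i, centeredChar (siteDensity ψ (α i) σ) ξ := fun σ =>
    continuous_finsetProd _ fun i _ => (hreg i σ).2.2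
  have key := fun σ => convDensity_at_mean (hc σ) (h0 σ) (fun i => (hreg i σ).1) (hb σ).choose_spec
    (h (n + 1) hn α σ hα).1 (hχc σ)
  have hpos := convDensity_pos (hc 0) (h0 0) (fun i => (hreg i 0).1) (hb 0).choose_spec
  refine ⟨(key 0).1, hpos, fun s => ?_⟩
  obtain ⟨σ, rfl⟩ := exists_sum_densityMean_eq n.succ_pos (hc 0) (h0 0)
    (fun i σ => (hreg i σ).1.congr (Filter.Eventually.of_forall
      fun x => siteDensity_eq_exp_mul ψ (α i) σ x)) s
  simp only [← siteDensity_eq_exp_mul]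
  refine deriv2_log_le_of_exp_tilt hpos (key 0).1 (convDensity_siteDensity ψ α σ) ?_
  obtain ⟨-, hval, hder⟩ := key σ
  obtain ⟨h_int, hmom⟩ := h (n + 1) hn α σ hα
  change deriv (deriv (convDensity fun i => siteDensity ψ (α i) σ))
    (∑ i, densityMean (siteDensity ψ (α i) σ)) ≤ _ *
    convDensity (fun i => siteDensity ψ (α i) σ) (∑ i, densityMean (siteDensity ψ (α i) σ))
  rw [hval, hder]
  have hZ : 0 ≤ ∏ i, ∫ x, siteDensity ψ (α i) σ x :=
    Finset.prod_nonneg fun i _ => integral_nonneg fun x => (h0 σ i x).le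
  have hn : Integrable fun ξ => ‖∏ i, centeredChar (siteDensity ψ (α i) σ) ξ‖ := by
    refine h_int.mono' (hχc σ).norm.aestronglyMeasurable (Filter.Eventually.of_forall fun ξ => ?_)
    rw [norm_norm]
    exact le_mul_of_one_le_left (norm_nonneg _) (by nlinarith [sq_nonneg ξ])
  have hre : ∫ ξ, (∏ i, centeredChar (siteDensity ψ (α i) σ) ξ).re ≤
      ∫ ξ, ‖∏ i, centeredChar (siteDensity ψ (α i) σ) ξ‖ :=
    integral_mono (hn.mono' (Complex.continuous_re.comp (hχc σ)).aestronglyMeasurable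
      (Filter.Eventually.of_forall fun ξ => Complex.abs_re_le_norm _)) hn
      fun ξ => Complex.re_le_norm _
  have h2 := (mul_le_mul_of_nonneg_left hre
    (by positivity : 0 ≤ κ / (n + 1 : ℕ))).trans hmom
  have h3 := mul_le_mul_of_nonneg_left h2 (mul_nonneg (by positivity : 0 ≤ 4 * π ^ 2) hZ)
  refine (le_of_eq ?_).trans ((neg_le_neg h3).trans (le_of_eq ?_))
  · ring
  · ring

/-- The chart `y ↦ (y, -∑ i, y i)` of the hyperplane of vectors with vanishing sum. -/
def zeroSumChart (n : ℕ) : (Fin n → ℝ) →ₗ[ℝ] EuclideanSpace ℝ (Fin (n + 1)) where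
  toFun y := WithLp.toLp 2 (Fin.snoc (α := fun _ => ℝ) y (-∑ i, y i))
  map_add' y z := by
    ext i
    refine Fin.lastCases ?_ (fun i => ?_) i <;>
      simp [Finset.sum_add_distrib, add_comm]
  map_smul' c y := by
    ext i
    refine Fin.lastCases ?_ (fun i => ?_) i <;> simp [Finset.mul_sum]

@[simp] theorem zeroSumChart_castSucc {n : ℕ} (y : Fin n → ℝ) (i : Fin n) :
    zeroSumChart n y i.castSucc = y i := by
  simp [zeroSumChart]

@[simp] theorem zeroSumChart_last {n : ℕ} (y : Fin n → ℝ) :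
    zeroSumChart n y (Fin.last n) = -∑ i, y i := by
  simp [zeroSumChart]

theorem zeroSumChart_injective (n : ℕ) : Function.Injective (zeroSumChart n) := fun y z h => by
  ext i
  rw [← zeroSumChart_castSucc y i, h, zeroSumChart_castSucc]

/-- The slice `∑ i, x i = s` of `ℝⁿ⁺¹` with its Hausdorff measure is, up to a constant independent
of `s`, parametrized by its first `n` coordinates with Lebesgue measure. -/
theorem exists_setIntegral_hausdorffMeasure_sum_eq (n : ℕ) :
    ∃ c : ℝ, 0 < c ∧ ∀ (F : EuclideanSpace ℝ (Fin (n + 1)) → ℝ) (s : ℝ),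
      ∫ x in {x : EuclideanSpace ℝ (Fin (n + 1)) | ∑ i, x i = s}, F x ∂μH[(n : ℝ)] =
        c * ∫ y, F (zeroSumChart n y + EuclideanSpace.single (Fin.last n) s) := by
  set V := LinearMap.range (zeroSumChart n)
  let e : (Fin n → ℝ) ≃L[ℝ] V :=
    (LinearEquiv.ofInjective _ (zeroSumChart_injective n)).toContinuousLinearEquiv
  have he : ∀ y, ((e y : V) : EuclideanSpace ℝ (Fin (n + 1))) = zeroSumChart n y := fun y => rfl
  have hdim : (Module.finrank ℝ V : ℝ) = n := by
    rw [← e.toLinearEquiv.finrank_eq, Module.finrank_fin_fun]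
  have hhaar : (μH[(n : ℝ)] : Measure V).IsAddHaarMeasure := hdim ▸ inferInstance
  have hhaar' : (Measure.map e volume).IsAddHaarMeasure := e.isAddHaarMeasure_map _
  obtain ⟨c, hc0, hc⟩ : ∃ c : NNReal, c ≠ 0 ∧
      (μH[(n : ℝ)] : Measure V) = c • Measure.map e volume := by
    refine ⟨_, ?_, Measure.isAddLeftInvariant_eq_smul _ _⟩
    exact (Measure.addHaarScalarFactor_pos_of_isAddHaarMeasure _ _).ne'
  refine ⟨c, by positivity, fun F s => ?_⟩
  set j : V → EuclideanSpace ℝ (Fin (n + 1)) := fun v => v + EuclideanSpace.single (Fin.last n) s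
  have hj : Isometry j := (isometry_add_right _).comp isometry_subtype_coe
  have hjr : Set.range j = {x | ∑ i, x i = s} := by
    ext x
    constructor
    · rintro ⟨⟨-, y, rfl⟩, rfl⟩
      simp [j, Fin.sum_univ_castSucc, Fin.castSucc_ne_last]
    · intro hx
      refine ⟨e fun i => x i.castSucc, ?_⟩
      simp only [j, he]
      ext i
      rw [Set.mem_ofPred_eq, Fin.sum_univ_castSucc] at hx
      refine Fin.lastCases ?_ (fun i => ?_) i
      · simp; linarith
      · simp [Fin.castSucc_ne_last]
  rw [← hjr, ← hj.map_hausdorffMeasure (Or.inl n.cast_nonneg),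
    hj.isClosedEmbedding.measurableEmbedding.integral_map, hc, integral_smul_nnreal_measure,
    (show MeasurableEmbedding e from e.toHomeomorph.measurableEmbedding).integral_map]
  rfl

theorem exists_psiK_eq_log_convDensity (ψ : ℝ → ℝ) (n : ℕ) :
    ∃ c : ℝ, 0 < c ∧ ∀ (α : Fin (n + 1) → ℝ) (m : ℝ), psiK ψ (n + 1) α m =
      -(1 / ((n + 1 : ℕ) : ℝ)) *
        log (c * convDensity (fun i => siteDensity ψ (α i) 0) ((n + 1 : ℕ) * m)) := by
  obtain ⟨c, hc, h⟩ := exists_setIntegral_hausdorffMeasure_sum_eq n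
  refine ⟨c, hc, fun α m => ?_⟩
  have hn : ((n + 1 : ℕ) : ℝ) - 1 = n := by push_cast; ring
  rw [psiK, hn, h, convDensity]
  congr 4; ext y
  rw [Fin.sum_univ_castSucc, neg_add, exp_add, ← Finset.sum_neg_distrib, exp_sum]
  simp [siteDensity, Fin.castSucc_ne_last, sub_eq_add_neg, add_comm]

/-- Smoothness and uniform convexity of the coarse-grained single-site potential. -/
theorem exists_psiK_uniformly_convex {ψ ψc δψ : ℝ → ℝ} {lam0 B L : ℝ}
    (hlam0 : 0 < lam0) (hB : 0 ≤ B) (hL : 0 < L)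
    (hsplit : ∀ x, ψ x = ψc x + δψ x)
    (hψc : ContDiff ℝ 2 ψc) (hδψ : ContDiff ℝ 2 δψ)
    (hconv : ∀ x, lam0 ≤ deriv (deriv ψc) x) (hb1 : ∀ x, |deriv δψ x| ≤ B) :
    ∃ (K₀ : ℕ) (lam : ℝ), 0 < lam ∧ ∀ K : ℕ, K₀ ≤ K → ∀ α : Fin K → ℝ, (∀ i, |α i| ≤ L) →
      ContDiff ℝ 2 (psiK ψ K α) ∧ ∀ m, lam ≤ deriv (deriv (psiK ψ K α)) m := by
  obtain ⟨K₀, c, hc, hK₀, h⟩ :=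
    exists_log_convDensity_deriv2_le hlam0 hB hL hsplit hψc hδψ hconv hb1
  refine ⟨K₀, c, hc, fun K hK α hα => ?_⟩
  obtain ⟨n, rfl⟩ : ∃ n, K = n + 1 := ⟨K - 1, by omega⟩
  obtain ⟨hPC, hP, hlog⟩ := h n hK α hα
  obtain ⟨b, hb, hψ⟩ := exists_psiK_eq_log_convDensity ψ n
  set P := convDensity fun i => siteDensity ψ (α i) 0
  have hN : (0 : ℝ) < (n + 1 : ℕ) := by positivity
  set N : ℝ := ((n + 1 : ℕ) : ℝ)
  set g : ℝ → ℝ := fun s => log (P s) with hg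
  have hgC : ContDiff ℝ 2 g := hPC.log fun x => (hP x).ne'
  have hgd : Differentiable ℝ g := hgC.differentiable (by norm_num)
  have hgd' : Differentiable ℝ (deriv g) :=
    ((contDiff_succ_iff_deriv (n := 1)).1 hgC).2.2.differentiable (by norm_num)
  have heq : psiK ψ (n + 1) α = fun m => -(1 / N) * (log b + g (N * m)) := by
    ext m
    rw [hψ, log_mul hb.ne' (hP _).ne']
  have hlin : ∀ m, HasDerivAt (fun m => N * m) N m := fun m => by
    simpa using (hasDerivAt_id m).const_mul N
  have hd : deriv (psiK ψ (n + 1) α) = fun m => -deriv g (N * m) := by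
    ext m
    rw [heq]
    have := ((((hgd (N * m)).hasDerivAt.comp m (hlin m)).const_add (log b)).const_mul
      (-(1 / N))).deriv
    refine this.trans ?_
    field_simp
  refine ⟨by rw [heq]; fun_prop, fun m => ?_⟩
  have h2 : deriv (fun m => -deriv g (N * m)) m = -(deriv (deriv g) (N * m) * N) :=
    ((hgd' (N * m)).hasDerivAt.comp m (hlin m)).neg.deriv
  rw [hd, h2]
  have := mul_le_mul_of_nonneg_right (hlog (N * m)) hN.le
  rw [neg_mul, div_mul_cancel₀ _ hN.ne'] at this
  linarith

theorem iteratedFDeriv_two_comp_apply {M : ℕ} {g : ℝ → ℝ} (hg : ContDiff ℝ 2 g) (i : Fin M)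
    (y v : EuclideanSpace ℝ (Fin M)) :
    iteratedFDeriv ℝ 2 (fun y : EuclideanSpace ℝ (Fin M) => g (y i)) y ![v, v] =
      (v i) ^ 2 * deriv (deriv g) (y i) := by
  have := (EuclideanSpace.proj i : EuclideanSpace ℝ (Fin M) →L[ℝ] ℝ).iteratedFDeriv_comp_right
    hg y (i := 2) le_rfl
  have h2 : iteratedFDeriv ℝ 2 (fun y : EuclideanSpace ℝ (Fin M) => g (y i)) y = _ := this
  rw [h2, ContinuousMultilinearMap.compContinuousLinearMap_apply,
    iteratedFDeriv_apply_eq_iteratedDeriv_mul_prod, iteratedDeriv_succ, iteratedDeriv_one]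
  simp [Fin.prod_univ_two, sq]

theorem iteratedFDeriv_HbarFun {ψ : ℝ → ℝ} {K M : ℕ} {a : Fin (K * M) → ℝ}
    (h : ∀ i, ContDiff ℝ 2 (psiK ψ K fun j => a (blockIdx K M i j))) :
    ContDiff ℝ 2 (HbarFun ψ K M a) ∧ ∀ y v : EuclideanSpace ℝ (Fin M),
      iteratedFDeriv ℝ 2 (HbarFun ψ K M a) y ![v, v] = (1 / (M : ℝ)) * ∑ i, (v i) ^ 2 *
        deriv (deriv (psiK ψ K fun j => a (blockIdx K M i j))) (y i) := by
  have hi : ∀ i, ContDiff ℝ 2 fun y : EuclideanSpace ℝ (Fin M) =>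
      psiK ψ K (fun j => a (blockIdx K M i j)) (y i) := fun i =>
    (h i).comp (EuclideanSpace.proj i : EuclideanSpace ℝ (Fin M) →L[ℝ] ℝ).contDiff
  have hs : ContDiff ℝ 2 fun y : EuclideanSpace ℝ (Fin M) =>
      ∑ i, psiK ψ K (fun j => a (blockIdx K M i j)) (y i) := ContDiff.sum fun i _ => hi i
  have heq : HbarFun ψ K M a = fun y => (1 / (M : ℝ)) •
      ∑ i, psiK ψ K (fun j => a (blockIdx K M i j)) (y i) := rfl
  refine ⟨by rw [heq]; exact hs.const_smul _, fun y v => ?_⟩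
  rw [heq, iteratedFDeriv_const_smul_apply' hs.contDiffAt, iteratedFDeriv_sum fun i _ => hi i]
  simp [iteratedFDeriv_two_comp_apply (h _)]

/-- Uniform convexity of the coarse-grained Hamiltonian: there are `K₀` and
`λ > 0`, depending only on `ψ` and `L`, such that for `K ≥ K₀`, any `M` and any `a` with
`max|aᵢ| ≤ L`, the function `H̄` is twice differentiable and
`D²H̄(y)[ỹ,ỹ] ≥ λ|ỹ|²_Y` for all `y, ỹ`, where `|ỹ|²_Y = (1/M)∑ ỹᵢ²`. -/
theorem statement2
    (ψ ψc δψ : ℝ → ℝ) (lam0 B L : ℝ)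
    (hlam0 : 0 < lam0) (hB : 0 ≤ B) (hL : 0 < L)
    (hsplit : ∀ x, ψ x = ψc x + δψ x)
    (hψc : ContDiff ℝ 2 ψc) (hδψ : ContDiff ℝ 2 δψ)
    (hconv : ∀ x, lam0 ≤ deriv (deriv ψc) x)
    (hb0 : ∀ x, |δψ x| ≤ B) (hb1 : ∀ x, |deriv δψ x| ≤ B)
    (hb2 : ∀ x, |deriv (deriv δψ) x| ≤ B) :
    ∃ (K₀ : ℕ) (lam : ℝ), 0 < lam ∧
      ∀ K : ℕ, K₀ ≤ K → ∀ (M : ℕ) (a : Fin (K * M) → ℝ), (∀ i, |a i| ≤ L) →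
        ContDiff ℝ 2 (HbarFun ψ K M a) ∧
        ∀ y v : EuclideanSpace ℝ (Fin M),
          lam * ((1 / (M : ℝ)) * ∑ i, (v i) ^ 2)
            ≤ iteratedFDeriv ℝ 2 (HbarFun ψ K M a) y ![v, v] := by
  obtain ⟨K₀, lam, hlam, h⟩ :=
    exists_psiK_uniformly_convex hlam0 hB hL hsplit hψc hδψ hconv hb1
  refine ⟨K₀, lam, hlam, fun K hK M a ha => ?_⟩
  have hψ := fun i : Fin M => h K hK (fun j => a (blockIdx K M i j)) fun j => ha _
  obtain ⟨hC, hD⟩ := iteratedFDeriv_HbarFun fun i => (hψ i).1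
  refine ⟨hC, fun y v => ?_⟩
  rw [hD, mul_left_comm, Finset.mul_sum]
  gcongr (1 / (M : ℝ)) * ?_
  refine Finset.sum_le_sum fun i _ => ?_
  rw [mul_comm]
  exact mul_le_mul_of_nonneg_left ((hψ i).2 _) (sq_nonneg _)
end
end

section
/- (One-dimensional asymmetric Brascamp–Lieb inequality.) Let ν(dx) = Z^{-1}exp(−ψ(x))dx be a probability measure on ℝ, where ψ = ψ_c + δψ with ψ_c ∈ C²(ℝ), ψ_c''(x) > 0 for all x, and δψ bounded. Then for all C¹ functions f and g (with f, f' ν-integrable and g'/ψ_c'' bounded), |cov_ν(f,g)| ≤ exp(3·osc(δψ)) · sup_x |g'(x)/ψ_c''(x)| · ∫ |f'| dν. -/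
open MeasureTheory ENNReal Real

noncomputable section

/-- Covariance of two real functions with respect to a measure. -/
def covFn {X : Type*} [MeasurableSpace X] (μ : Measure X) (f g : X → ℝ) : ℝ :=
  (∫ x, f x * g x ∂μ) - (∫ x, f x ∂μ) * (∫ x, g x ∂μ)

/-- The probability measure `ν(dx) = Z⁻¹ exp(-ψ(x)) dx` on `ℝ`. -/
def nuMeas (ψ : ℝ → ℝ) : Measure ℝ :=
  let ν : Measure ℝ := volume.withDensity fun x => ENNReal.ofReal (Real.exp (-ψ x))
  (ν Set.univ)⁻¹ • ν

open Set Filter Topology in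
/-- A truncated integration by parts on the right half-line: only the boundary term at `t`
survives as an upper bound. -/
lemma setIntegral_Ioi_sub_mul_exp_neg_le {u φ : ℝ → ℝ} (hu : ∀ x, HasDerivAt u (φ x) x)
    (hφc : Continuous φ) (hφ : Monotone φ) (hint : Integrable fun x => Real.exp (-u x)) (t : ℝ) :
    IntegrableOn (fun x => (φ x - φ t) * Real.exp (-u x)) (Ioi t) ∧
      ∫ x in Ioi t, (φ x - φ t) * Real.exp (-u x) ≤
        Real.exp (-u t) - φ t * ∫ x in Ioi t, Real.exp (-u x) := by
  have huc : Continuous u := continuous_iff_continuousAt.2 fun x => (hu x).continuousAt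
  have hFTC : ∀ b, ∫ x in t..b, (φ x - φ t) * Real.exp (-u x) =
      Real.exp (-u t) - Real.exp (-u b) - φ t * ∫ x in t..b, Real.exp (-u x) := by
    intro b
    have h1 : ∫ x in t..b, φ x * Real.exp (-u x) = Real.exp (-u t) - Real.exp (-u b) := by
      rw [intervalIntegral.integral_eq_sub_of_hasDerivAt (f := fun x => -Real.exp (-u x))
        (fun x _ => by simpa [mul_comm] using (hu x).fun_neg.exp.fun_neg)
        (by apply Continuous.intervalIntegrable; fun_prop)]
      ring
    simp_rw [sub_mul]
    rw [intervalIntegral.integral_sub, h1, intervalIntegral.integral_const_mul] <;>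
      apply Continuous.intervalIntegrable <;> fun_prop
  have hI : IntegrableOn (fun x => (φ x - φ t) * Real.exp (-u x)) (Ioi t) := by
    refine integrableOn_Ioi_of_intervalIntegral_norm_bounded (l := atTop) (b := id)
      (Real.exp (-u t) + |φ t| * ∫ x, Real.exp (-u x)) t
      (fun b => Continuous.integrableOn_Ioc (by fun_prop)) tendsto_id ?_
    filter_upwards [eventually_ge_atTop t] with b hb
    have h2 : ∫ x in t..b, ‖(φ x - φ t) * Real.exp (-u x)‖ =
        ∫ x in t..b, (φ x - φ t) * Real.exp (-u x) := by
      refine intervalIntegral.integral_congr fun x hx => ?_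
      rw [uIcc_of_le hb] at hx
      exact Real.norm_of_nonneg (mul_nonneg (sub_nonneg.2 (hφ hx.1)) (Real.exp_pos _).le)
    have h3 : 0 ≤ ∫ x in t..b, Real.exp (-u x) :=
      intervalIntegral.integral_nonneg hb fun x _ => (Real.exp_pos _).le
    have h4 : ∫ x in t..b, Real.exp (-u x) ≤ ∫ x, Real.exp (-u x) := by
      rw [intervalIntegral.integral_of_le hb]
      exact setIntegral_le_integral hint (ae_of_all _ fun x => (Real.exp_pos _).le)
    have h5 : -(φ t) * ∫ x in t..b, Real.exp (-u x) ≤ |φ t| * ∫ x, Real.exp (-u x) :=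
      mul_le_mul (neg_le_abs _) h4 h3 (abs_nonneg _)
    simp only [id]
    rw [h2, hFTC]
    linarith [Real.exp_pos (-u b)]
  refine ⟨hI, le_of_tendsto_of_tendsto' (intervalIntegral_tendsto_integral_Ioi t hI tendsto_id)
    (((intervalIntegral_tendsto_integral_Ioi t hint.integrableOn tendsto_id).const_mul
      (φ t)).const_sub (Real.exp (-u t))) fun b => ?_⟩
  simp only [id]
  rw [hFTC]
  linarith [Real.exp_pos (-u b)]

open Set Filter Topology in
/-- The mirror image of `setIntegral_Ioi_sub_mul_exp_neg_le`. -/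
lemma setIntegral_Iic_sub_mul_exp_neg_le {u φ : ℝ → ℝ} (hu : ∀ x, HasDerivAt u (φ x) x)
    (hφc : Continuous φ) (hφ : Monotone φ) (hint : Integrable fun x => Real.exp (-u x)) (t : ℝ) :
    IntegrableOn (fun x => (φ t - φ x) * Real.exp (-u x)) (Iic t) ∧
      ∫ x in Iic t, (φ t - φ x) * Real.exp (-u x) ≤
        Real.exp (-u t) + φ t * ∫ x in Iic t, Real.exp (-u x) := by
  obtain ⟨h1, h2⟩ := setIntegral_Ioi_sub_mul_exp_neg_le (u := fun x => u (-x))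
    (φ := fun x => -φ (-x))
    (fun x => by simpa [Function.comp_def] using (hu (-x)).comp x (hasDerivAt_neg x))
    (by fun_prop) (fun x y hxy => neg_le_neg (hφ (neg_le_neg hxy))) hint.comp_neg (-t)
  have hfun : (fun x => (-φ (-x) - -φ (- -t)) * Real.exp (-u (-x))) =
      fun x => (fun y => (φ t - φ y) * Real.exp (-u y)) (-x) := by
    funext x
    rw [neg_neg]
    ring
  rw [hfun] at h1 h2
  rw [integral_comp_neg_Ioi (-t) fun y => (φ t - φ y) * Real.exp (-u y),
    integral_comp_neg_Ioi (-t) fun y => Real.exp (-u y)] at h2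
  rw [neg_neg] at h2
  refine ⟨?_, by linarith⟩
  rw [← integrableOn_Ici_iff_integrableOn_Ioi] at h1
  simpa using h1.comp_neg

open Set in
lemma lintegral_Ioi_lintegral_Iic_le {u φ : ℝ → ℝ} (hu : ∀ x, HasDerivAt u (φ x) x)
    (hφc : Continuous φ) (hφ : Monotone φ) (hint : Integrable fun x => Real.exp (-u x)) (t : ℝ) :
    ∫⁻ x in Ioi t, ∫⁻ y in Iic t, ENNReal.ofReal (Real.exp (-u x)) *
        (ENNReal.ofReal (Real.exp (-u y)) * ENNReal.ofReal (φ x - φ y)) ≤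
      ENNReal.ofReal (Real.exp (-u t) * ∫ x, Real.exp (-u x)) := by
  have huc : Continuous u := continuous_iff_continuousAt.2 fun x => (hu x).continuousAt
  obtain ⟨hA, hA'⟩ := setIntegral_Ioi_sub_mul_exp_neg_le hu hφc hφ hint t
  obtain ⟨hB, hB'⟩ := setIntegral_Iic_sub_mul_exp_neg_le hu hφc hφ hint t
  set E : ℝ → ℝ := fun x => Real.exp (-u x)
  have hE0 : ∀ x, 0 ≤ E x := fun x => (Real.exp_pos _).le
  have hEm : Measurable E := by fun_prop
  have hφm : Measurable φ := hφc.measurable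
  set A := ∫ x in Ioi t, (φ x - φ t) * E x
  set C := ∫ x in Iic t, (φ t - φ x) * E x
  set R := ∫ x in Ioi t, E x
  set L := ∫ x in Iic t, E x
  have hA0 : 0 ≤ A := setIntegral_nonneg measurableSet_Ioi fun x hx =>
    mul_nonneg (sub_nonneg.2 (hφ (le_of_lt hx))) (hE0 x)
  have hC0 : 0 ≤ C := setIntegral_nonneg measurableSet_Iic fun x hx =>
    mul_nonneg (sub_nonneg.2 (hφ hx)) (hE0 x)
  have hR0 : 0 ≤ R := setIntegral_nonneg measurableSet_Ioi fun x _ => hE0 x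
  have hL0 : 0 ≤ L := setIntegral_nonneg measurableSet_Iic fun x _ => hE0 x
  have eA : ∫⁻ x in Ioi t, ENNReal.ofReal ((φ x - φ t) * E x) = ENNReal.ofReal A :=
    (ofReal_integral_eq_lintegral_ofReal hA ((ae_restrict_iff' measurableSet_Ioi).2 (ae_of_all _
      fun x hx => mul_nonneg (sub_nonneg.2 (hφ (le_of_lt hx))) (hE0 x)))).symm
  have eC : ∫⁻ x in Iic t, ENNReal.ofReal ((φ t - φ x) * E x) = ENNReal.ofReal C :=
    (ofReal_integral_eq_lintegral_ofReal hB ((ae_restrict_iff' measurableSet_Iic).2 (ae_of_all _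
      fun x hx => mul_nonneg (sub_nonneg.2 (hφ hx)) (hE0 x)))).symm
  have eR : ∫⁻ x in Ioi t, ENNReal.ofReal (E x) = ENNReal.ofReal R :=
    (ofReal_integral_eq_lintegral_ofReal hint.integrableOn (ae_of_all _ hE0)).symm
  have eL : ∫⁻ x in Iic t, ENNReal.ofReal (E x) = ENNReal.ofReal L :=
    (ofReal_integral_eq_lintegral_ofReal hint.integrableOn (ae_of_all _ hE0)).symm
  have hin : ∀ x ∈ Ioi t, ∫⁻ y in Iic t, ENNReal.ofReal (E x) *
      (ENNReal.ofReal (E y) * ENNReal.ofReal (φ x - φ y)) =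
      ENNReal.ofReal ((φ x - φ t) * E x) * ENNReal.ofReal L +
        ENNReal.ofReal (E x) * ENNReal.ofReal C := by
    intro x hx
    have hx' : 0 ≤ φ x - φ t := sub_nonneg.2 (hφ (le_of_lt hx))
    rw [← eL, ← eC, ← lintegral_const_mul _ (by fun_prop), ← lintegral_const_mul _ (by fun_prop),
      ← lintegral_add_left (by fun_prop)]
    refine setLIntegral_congr_fun measurableSet_Iic fun y hy => ?_
    have hy' : 0 ≤ φ t - φ y := sub_nonneg.2 (hφ hy)
    have hxy : 0 ≤ φ x - φ y := by linarith
    rw [← ENNReal.ofReal_mul (hE0 y), ← ENNReal.ofReal_mul (hE0 x),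
      ← ENNReal.ofReal_mul (mul_nonneg hx' (hE0 x)), ← ENNReal.ofReal_mul (hE0 x),
      ← ENNReal.ofReal_add (mul_nonneg (mul_nonneg hx' (hE0 x)) (hE0 y))
        (mul_nonneg (hE0 x) (mul_nonneg hy' (hE0 y)))]
    congr 1
    ring
  rw [setLIntegral_congr_fun measurableSet_Ioi hin, lintegral_add_left (by fun_prop),
    lintegral_mul_const _ (by fun_prop), lintegral_mul_const _ (by fun_prop), eA, eR,
    ← ENNReal.ofReal_mul hA0, ← ENNReal.ofReal_mul hR0,
    ← ENNReal.ofReal_add (mul_nonneg hA0 hL0) (mul_nonneg hR0 hC0)]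
  refine ENNReal.ofReal_le_ofReal ?_
  have hsum : ∫ x, E x = L + R := (intervalIntegral.integral_Iic_add_Ioi hint.integrableOn
    hint.integrableOn).symm
  rw [hsum]
  change _ ≤ E t * (L + R)
  nlinarith [mul_le_mul_of_nonneg_right hA' hL0, mul_le_mul_of_nonneg_left hB' hR0]

open Set in
lemma enorm_covFn_le {μ : Measure ℝ} [IsProbabilityMeasure μ] {f g : ℝ → ℝ}
    (hf : Integrable f μ) (hg : Integrable g μ) (hfg : Integrable (fun x => f x * g x) μ)
    (hfm : Measurable f) (hgm : Measurable g) :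
    ‖covFn μ f g‖ₑ ≤ ∫⁻ x, ∫⁻ y in Iio x, ‖f x - f y‖ₑ * ‖g x - g y‖ₑ ∂μ ∂μ := by
  set F : ℝ × ℝ → ℝ := fun p => (f p.1 - f p.2) * (g p.1 - g p.2) with hF
  have hcov : 2 * covFn μ f g = ∫ p, F p ∂(μ.prod μ) := by
    have i1 : Integrable (fun p : ℝ × ℝ => f p.1 * g p.1) (μ.prod μ) := hfg.comp_fst μ
    have i2 : Integrable (fun p : ℝ × ℝ => f p.2 * g p.2) (μ.prod μ) := hfg.comp_snd μ
    have i3 : Integrable (fun p : ℝ × ℝ => f p.1 * g p.2) (μ.prod μ) := hf.mul_prod hg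
    have i4 : Integrable (fun p : ℝ × ℝ => g p.1 * f p.2) (μ.prod μ) := hg.mul_prod hf
    have hFe : F = fun p => (f p.1 * g p.1 + f p.2 * g p.2) - (f p.1 * g p.2 + g p.1 * f p.2) := by
      funext p
      simp only [hF]
      ring
    have e1 : ∫ p : ℝ × ℝ, f p.1 * g p.1 ∂(μ.prod μ) = ∫ x, f x * g x ∂μ := by
      simpa using integral_fun_fst (μ := μ) (ν := μ) fun x => f x * g x
    have e2 : ∫ p : ℝ × ℝ, f p.2 * g p.2 ∂(μ.prod μ) = ∫ x, f x * g x ∂μ := by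
      simpa using integral_fun_snd (μ := μ) (ν := μ) fun x => f x * g x
    rw [hFe, integral_sub (by exact i1.add i2) (by exact i3.add i4), integral_add i1 i2,
      integral_add i3 i4, e1, e2, integral_prod_mul, integral_prod_mul, covFn]
    ring
  set G : ℝ → ℝ → ℝ≥0∞ := fun x y => (Iio x).indicator (fun y => ‖F (x, y)‖ₑ) y with hG
  have hGm : Measurable (Function.uncurry G) := by
    have : Function.uncurry G = {p : ℝ × ℝ | p.2 < p.1}.indicator fun p => ‖F p‖ₑ := by
      funext p
      simp [hG, Function.uncurry, indicator]
    rw [this]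
    exact Measurable.indicator (by fun_prop) (measurableSet_lt measurable_snd measurable_fst)
  have hle : ∀ x y, ‖F (x, y)‖ₑ ≤ G x y + G y x := by
    intro x y
    rcases lt_trichotomy x y with h | h | h
    · have : F (x, y) = F (y, x) := by simp only [hF]; ring
      simp [hG, indicator, h, this]
    · simp [hF, h]
    · simp [hG, indicator, h]
  have hmain : 2 * ‖covFn μ f g‖ₑ ≤ 2 * ∫⁻ x, ∫⁻ y, G x y ∂μ ∂μ := by
    calc 2 * ‖covFn μ f g‖ₑ = ‖∫ p, F p ∂(μ.prod μ)‖ₑ := by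
          rw [← hcov, enorm_mul]
          congr 1
          simp [Real.enorm_eq_ofReal_abs]
      _ ≤ ∫⁻ p, ‖F p‖ₑ ∂(μ.prod μ) := enorm_integral_le_lintegral_enorm _
      _ = ∫⁻ x, ∫⁻ y, ‖F (x, y)‖ₑ ∂μ ∂μ := lintegral_prod _ (by fun_prop)
      _ ≤ ∫⁻ x, ∫⁻ y, (G x y + G y x) ∂μ ∂μ :=
          lintegral_mono fun x => lintegral_mono fun y => hle x y
      _ = 2 * ∫⁻ x, ∫⁻ y, G x y ∂μ ∂μ := by
          have h1 : ∀ x, Measurable (G x) := fun x => hGm.of_uncurry_left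
          simp_rw [lintegral_add_left (h1 _)]
          rw [lintegral_add_left (by exact hGm.lintegral_prod_right'), two_mul]
          congr 1
          exact (lintegral_lintegral_swap (f := G) hGm.aemeasurable).symm
  have h2 := (ENNReal.mul_le_mul_iff_right (by norm_num) (by norm_num)).1 hmain
  refine h2.trans_eq (lintegral_congr fun x => ?_)
  rw [lintegral_indicator measurableSet_Iio]
  simp [hF, enorm_mul]

open Set in
lemma lintegral_enorm_sub_mul_le {μ : Measure ℝ} [SFinite μ] {f : ℝ → ℝ}
    (hf : ContDiff ℝ 1 f) {k : ℝ → ℝ → ℝ≥0∞} (hk : Measurable (Function.uncurry k)) :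
    ∫⁻ x, ∫⁻ y in Iio x, ‖f x - f y‖ₑ * k x y ∂μ ∂μ ≤
      ∫⁻ t, ‖deriv f t‖ₑ * ∫⁻ x in Ioi t, ∫⁻ y in Iic t, k x y ∂μ ∂μ := by
  have hf' : Continuous (deriv f) := hf.continuous_deriv le_rfl
  have hdm : Measurable (deriv f) := hf'.measurable
  set T : Set (ℝ × ℝ × ℝ) := {p | p.2.1 ≤ p.2.2 ∧ p.2.2 < p.1} with hT
  have hTm : MeasurableSet T :=
    (measurableSet_le (f := fun p : ℝ × ℝ × ℝ => p.2.1) (g := fun p => p.2.2)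
      (by fun_prop) (by fun_prop)).inter
      (measurableSet_lt (f := fun p : ℝ × ℝ × ℝ => p.2.2) (g := fun p => p.1)
        (by fun_prop) (by fun_prop))
  set H : ℝ × ℝ × ℝ → ℝ≥0∞ := T.indicator fun p => ‖deriv f p.2.2‖ₑ * k p.1 p.2.1 with hH
  have hHm : Measurable H := by
    refine Measurable.indicator ?_ hTm
    have : Measurable fun p : ℝ × ℝ × ℝ => k p.1 p.2.1 :=
      hk.comp (measurable_fst.prodMk (measurable_fst.comp measurable_snd))
    fun_prop
  have hstep : ∀ x, ∀ y ∈ Iio x, ‖f x - f y‖ₑ * k x y ≤ ∫⁻ t, H (x, y, t) := by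
    intro x y hy
    have hyx : y ≤ x := le_of_lt hy
    have h1 : f x - f y = ∫ t in Ico y x, deriv f t := by
      rw [integral_Ico_eq_integral_Ioc, ← intervalIntegral.integral_of_le hyx,
        intervalIntegral.integral_deriv_eq_sub
          (fun z _ => (hf.differentiable one_ne_zero).differentiableAt) (hf'.intervalIntegrable _ _)]
    calc ‖f x - f y‖ₑ * k x y ≤ (∫⁻ t in Ico y x, ‖deriv f t‖ₑ) * k x y := by
          gcongr
          rw [h1]
          exact enorm_integral_le_lintegral_enorm _
      _ = ∫⁻ t, H (x, y, t) := by
          rw [← lintegral_mul_const _ (by fun_prop), ← lintegral_indicator measurableSet_Ico]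
          rfl
  calc ∫⁻ x, ∫⁻ y in Iio x, ‖f x - f y‖ₑ * k x y ∂μ ∂μ
      ≤ ∫⁻ x, ∫⁻ y, (∫⁻ t, H (x, y, t)) ∂μ ∂μ := lintegral_mono fun x =>
        (setLIntegral_mono' measurableSet_Iio (hstep x)).trans (setLIntegral_le_lintegral _ _)
    _ = ∫⁻ x, ∫⁻ t, ∫⁻ y, H (x, y, t) ∂μ ∂volume ∂μ := lintegral_congr fun x =>
        lintegral_lintegral_swap (μ := μ) (ν := volume) (f := fun y t => H (x, y, t)) (by
          change AEMeasurable (fun q : ℝ × ℝ => H (x, q.1, q.2)) _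
          fun_prop)
    _ = ∫⁻ t, ∫⁻ x, ∫⁻ y, H (x, y, t) ∂μ ∂μ :=
        lintegral_lintegral_swap (μ := μ) (ν := volume) (f := fun x t => ∫⁻ y, H (x, y, t) ∂μ) (by
          have : Measurable fun q : (ℝ × ℝ) × ℝ => H (q.1.1, q.2, q.1.2) := by fun_prop
          exact this.lintegral_prod_right'.aemeasurable)
    _ = _ := lintegral_congr fun t => by
        rw [← lintegral_const_mul _ ?_, ← lintegral_indicator measurableSet_Ioi]
        · refine lintegral_congr fun x => ?_
          by_cases hx : t < x
          · rw [indicator_of_mem (show x ∈ Ioi t from hx), ← lintegral_const_mul _ hk.of_uncurry_left,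
              ← lintegral_indicator measurableSet_Iic]
            refine lintegral_congr fun y => ?_
            simp [hH, hT, indicator, hx]
          · rw [indicator_of_notMem (show x ∉ Ioi t from hx)]
            simp [hH, hT, hx]
        · exact hk.lintegral_prod_right'

lemma abs_sub_le_iSup_mul_sub {g φ : ℝ → ℝ} (hg : Differentiable ℝ g) (hφ : Differentiable ℝ φ)
    (hpos : ∀ x, 0 < deriv φ x) {C : ℝ} (hC : ∀ x, |deriv g x / deriv φ x| ≤ C) {x y : ℝ}
    (hyx : y ≤ x) : |g x - g y| ≤ (⨆ z, |deriv g z / deriv φ z|) * (φ x - φ y) := by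
  set K := ⨆ z, |deriv g z / deriv φ z|
  have hK : ∀ z, |deriv g z| ≤ K * deriv φ z := fun z => by
    have : |deriv g z / deriv φ z| ≤ K :=
      le_ciSup (f := fun z => |deriv g z / deriv φ z|) ⟨C, Set.forall_mem_range.2 hC⟩ z
    rwa [abs_div, abs_of_pos (hpos z), div_le_iff₀ (hpos z)] at this
  have m1 : Monotone fun z => K * φ z - g z :=
    monotone_of_deriv_nonneg (by fun_prop) fun z => by
      rw [deriv_fun_sub (by fun_prop) (by fun_prop), deriv_const_mul _ (by fun_prop)]
      linarith [le_abs_self (deriv g z), hK z]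
  have m2 : Monotone fun z => K * φ z + g z :=
    monotone_of_deriv_nonneg (by fun_prop) fun z => by
      rw [deriv_fun_add (by fun_prop) (by fun_prop), deriv_const_mul _ (by fun_prop)]
      linarith [neg_abs_le (deriv g z), hK z]
  have h1 := m1 hyx
  have h2 := m2 hyx
  simp only at h1 h2
  rw [abs_le]
  constructor <;> linarith

lemma nuMeas_eq_withDensity (ψ : ℝ → ℝ) (hψ : Measurable ψ)
    (hint : Integrable fun x => Real.exp (-ψ x)) :
    nuMeas ψ = volume.withDensity fun x =>
      (ENNReal.ofReal (∫ y, Real.exp (-ψ y)))⁻¹ * ENNReal.ofReal (Real.exp (-ψ x)) := by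
  rw [nuMeas, withDensity_apply _ MeasurableSet.univ, Measure.restrict_univ,
    ← ofReal_integral_eq_lintegral_ofReal hint (ae_of_all _ fun x => (Real.exp_pos _).le),
    ← withDensity_smul _ (by fun_prop)]
  rfl

lemma isProbabilityMeasure_nuMeas (ψ : ℝ → ℝ) (hint : Integrable fun x => Real.exp (-ψ x)) :
    IsProbabilityMeasure (nuMeas ψ) := by
  refine ⟨?_⟩
  rw [nuMeas, Measure.smul_apply, smul_eq_mul, withDensity_apply _ MeasurableSet.univ,
    Measure.restrict_univ,
    ← ofReal_integral_eq_lintegral_ofReal hint (ae_of_all _ fun x => (Real.exp_pos _).le)]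
  exact ENNReal.inv_mul_cancel (ENNReal.ofReal_pos.2 (integral_exp_pos hint)).ne'
    ENNReal.ofReal_ne_top

open Set in
/-- The perturbed kernel bound: perturbing the convex potential by `δ` with values in `[m, M]`
costs at most the factor `exp (2 * (M - m))`. -/
lemma lintegral_Ioi_lintegral_Iic_nuMeas_le {u φ δ : ℝ → ℝ} (hu : ∀ x, HasDerivAt u (φ x) x)
    (hφc : Continuous φ) (hφ : Monotone φ) (hδ : Measurable δ) {m M : ℝ} (hm : ∀ x, m ≤ δ x)
    (hM : ∀ x, δ x ≤ M) (hint : Integrable fun x => Real.exp (-(u x + δ x))) (t : ℝ) :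
    ∫⁻ x in Ioi t, ∫⁻ y in Iic t, ENNReal.ofReal (φ x - φ y)
        ∂(nuMeas fun x => u x + δ x) ∂(nuMeas fun x => u x + δ x) ≤
      ENNReal.ofReal (Real.exp (2 * (M - m))) *
        ((ENNReal.ofReal (∫ y, Real.exp (-(u y + δ y))))⁻¹ *
          ENNReal.ofReal (Real.exp (-(u t + δ t)))) := by
  have huc : Continuous u := continuous_iff_continuousAt.2 fun x => (hu x).continuousAt
  have hum : Measurable u := huc.measurable
  have hφm : Measurable φ := hφc.measurable
  have hle : ∀ x, Real.exp (-u x) ≤ Real.exp M * Real.exp (-(u x + δ x)) := fun x => by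
    rw [← Real.exp_add]
    exact Real.exp_le_exp.2 (by linarith [hM x])
  have hge : ∀ x, Real.exp (-(u x + δ x)) ≤ Real.exp (-m) * Real.exp (-u x) := fun x => by
    rw [← Real.exp_add]
    exact Real.exp_le_exp.2 (by linarith [hm x])
  have hintc : Integrable fun x => Real.exp (-u x) :=
    (hint.const_mul (Real.exp M)).mono' (by fun_prop) (ae_of_all _ fun x => by
      rw [Real.norm_of_nonneg (Real.exp_pos _).le]
      exact hle x)
  have hZpos : 0 < ∫ y, Real.exp (-(u y + δ y)) := integral_exp_pos hint
  have hZle : ∫ y, Real.exp (-u y) ≤ Real.exp M * ∫ y, Real.exp (-(u y + δ y)) := by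
    rw [← integral_const_mul]
    exact integral_mono hintc (hint.const_mul _) hle
  rw [nuMeas_eq_withDensity _ (by fun_prop) hint]
  set Z := ∫ y, Real.exp (-(u y + δ y))
  have hc : (ENNReal.ofReal Z)⁻¹ = ENNReal.ofReal Z⁻¹ := (ENNReal.ofReal_inv_of_pos hZpos).symm
  rw [hc]
  set w : ℝ → ℝ≥0∞ := fun x => ENNReal.ofReal Z⁻¹ * ENNReal.ofReal (Real.exp (-(u x + δ x)))
  have hw : Measurable w := by fun_prop
  set a := ENNReal.ofReal (Z⁻¹ * Real.exp (-m)) with ha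
  have ha' : a ≠ ⊤ := ENNReal.ofReal_ne_top
  have hwle : ∀ x, w x ≤ a * ENNReal.ofReal (Real.exp (-u x)) := fun x => by
    simp only [w, a]
    rw [← ENNReal.ofReal_mul (by positivity), ← ENNReal.ofReal_mul (by positivity), mul_assoc]
    exact ENNReal.ofReal_le_ofReal (mul_le_mul_of_nonneg_left (hge x) (by positivity))
  have hk : Measurable fun p : ℝ × ℝ => ENNReal.ofReal (φ p.1 - φ p.2) := by fun_prop
  rw [setLIntegral_withDensity_eq_setLIntegral_mul _ hw
    (by
      have := isProbabilityMeasure_nuMeas _ hint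
      rw [nuMeas_eq_withDensity _ (by fun_prop) hint, hc] at this
      exact hk.lintegral_prod_right') measurableSet_Ioi]
  simp only [Pi.mul_apply]
  calc ∫⁻ x in Ioi t, w x * ∫⁻ y in Iic t, ENNReal.ofReal (φ x - φ y) ∂(volume.withDensity w)
      = ∫⁻ x in Ioi t, w x * ∫⁻ y in Iic t, w y * ENNReal.ofReal (φ x - φ y) := by
        refine lintegral_congr fun x => ?_
        rw [setLIntegral_withDensity_eq_setLIntegral_mul _ hw (by fun_prop) measurableSet_Iic]
        rfl
    _ ≤ ∫⁻ x in Ioi t, (a * ENNReal.ofReal (Real.exp (-u x))) * ∫⁻ y in Iic t,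
          (a * ENNReal.ofReal (Real.exp (-u y))) * ENNReal.ofReal (φ x - φ y) := by
        gcongr with x y
        · exact hwle x
        · exact hwle y
    _ = a * (a * ∫⁻ x in Ioi t, ∫⁻ y in Iic t, ENNReal.ofReal (Real.exp (-u x)) *
          (ENNReal.ofReal (Real.exp (-u y)) * ENNReal.ofReal (φ x - φ y))) := by
        simp_rw [mul_assoc, lintegral_const_mul' _ _ ha',
          lintegral_const_mul' _ _ ENNReal.ofReal_ne_top, mul_left_comm _ a,
          lintegral_const_mul' _ _ ha']
    _ ≤ a * (a * ENNReal.ofReal (Real.exp (-u t) * ∫ x, Real.exp (-u x))) := by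
        gcongr
        exact lintegral_Ioi_lintegral_Iic_le hu hφc hφ hintc t
    _ ≤ a * (a * ENNReal.ofReal (Real.exp M * Real.exp (-(u t + δ t)) * (Real.exp M * Z))) := by
        gcongr
        exact hle t
    _ = _ := by
        rw [ha, ← ENNReal.ofReal_mul (by positivity), ← ENNReal.ofReal_mul (by positivity),
          ← ENNReal.ofReal_mul (by positivity), ← ENNReal.ofReal_mul (by positivity)]
        congr 1
        have : Real.exp (2 * (M - m)) =
            Real.exp (-m) * Real.exp (-m) * (Real.exp M * Real.exp M) := by
          simp only [← Real.exp_add]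
          congr 1
          ring
        rw [this]
        field_simp

/-- **one-dimensional asymmetric Brascamp–Lieb inequality.** If
`ψ = ψc + δψ` with `ψc'' > 0` and `δψ` bounded, then for `C¹` functions `f, g`
(with the relevant integrability and with `g'/ψc''` bounded),
`|cov_ν(f,g)| ≤ exp(3·osc(δψ)) · sup|g'/ψc''| · ∫|f'| dν`. -/
theorem statement5
    (ψ ψc δψ : ℝ → ℝ)
    (hsplit : ∀ x, ψ x = ψc x + δψ x)
    (hψc : ContDiff ℝ 2 ψc) (hconv : ∀ x, 0 < deriv (deriv ψc) x)
    (B : ℝ) (hδb : ∀ x, |δψ x| ≤ B) (hδm : Measurable δψ)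
    (hint : Integrable (fun x => Real.exp (-ψ x)))
    (f g : ℝ → ℝ) (hf : ContDiff ℝ 1 f) (hg : ContDiff ℝ 1 g)
    (hfi : Integrable f (nuMeas ψ)) (hgi : Integrable g (nuMeas ψ))
    (hfgi : Integrable (fun x => f x * g x) (nuMeas ψ))
    (hf'i : Integrable (fun x => |deriv f x|) (nuMeas ψ))
    (Cg : ℝ) (hgb : ∀ x, |deriv g x / deriv (deriv ψc) x| ≤ Cg) :
    |covFn (nuMeas ψ) f g| ≤
      Real.exp (3 * (sSup (Set.range δψ) - sInf (Set.range δψ)))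
        * (⨆ x : ℝ, |deriv g x / deriv (deriv ψc) x|)
        * ∫ x, |deriv f x| ∂(nuMeas ψ) := by
  obtain rfl : ψ = fun x => ψc x + δψ x := funext hsplit
  have hprob : IsProbabilityMeasure (nuMeas fun x => ψc x + δψ x) :=
    isProbabilityMeasure_nuMeas _ hint
  have hc' : ContDiff ℝ 1 (deriv ψc) := (contDiff_succ_iff_deriv.1 hψc).2.2
  have hφm : Measurable (deriv ψc) := hc'.continuous.measurable
  have hmono : Monotone (deriv ψc) :=
    monotone_of_deriv_nonneg (hc'.differentiable one_ne_zero) fun x => (hconv x).le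
  have hder : ∀ x, HasDerivAt ψc (deriv ψc x) x := fun x =>
    (hψc.differentiable two_ne_zero x).hasDerivAt
  have hm : ∀ x, sInf (Set.range δψ) ≤ δψ x := fun x =>
    csInf_le ⟨-B, Set.forall_mem_range.2 fun y => (abs_le.1 (hδb y)).1⟩ ⟨x, rfl⟩
  have hM : ∀ x, δψ x ≤ sSup (Set.range δψ) := fun x =>
    le_csSup ⟨B, Set.forall_mem_range.2 fun y => (abs_le.1 (hδb y)).2⟩ ⟨x, rfl⟩
  set m := sInf (Set.range δψ)
  set M := sSup (Set.range δψ)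
  have hgK := fun x y => abs_sub_le_iSup_mul_sub (x := x) (y := y)
    (hg.differentiable one_ne_zero) (hc'.differentiable one_ne_zero) hconv hgb
  set K := ⨆ x : ℝ, |deriv g x / deriv (deriv ψc) x|
  have hK : 0 ≤ K := Real.iSup_nonneg fun x => abs_nonneg _
  have hdf : Measurable (deriv f) := (hf.continuous_deriv le_rfl).measurable
  have hψm : Measurable fun x => ψc x + δψ x := hψc.continuous.measurable.add hδm
  set ν := nuMeas fun x => ψc x + δψ x with hν
  have hk : Measurable (Function.uncurry fun x y => ENNReal.ofReal (deriv ψc x - deriv ψc y)) := by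
    simp only [Function.uncurry_def]
    fun_prop
  have hmain : ‖covFn ν f g‖ₑ ≤ ENNReal.ofReal K *
      (ENNReal.ofReal (Real.exp (2 * (M - m))) * ∫⁻ t, ‖deriv f t‖ₑ ∂ν) := by
    calc ‖covFn ν f g‖ₑ
        ≤ ∫⁻ x, ∫⁻ y in Set.Iio x, ‖f x - f y‖ₑ * ‖g x - g y‖ₑ ∂ν ∂ν :=
          enorm_covFn_le hfi hgi hfgi hf.continuous.measurable hg.continuous.measurable
      _ ≤ ∫⁻ x, ∫⁻ y in Set.Iio x, ENNReal.ofReal K *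
            (‖f x - f y‖ₑ * ENNReal.ofReal (deriv ψc x - deriv ψc y)) ∂ν ∂ν := by
          refine lintegral_mono fun x => setLIntegral_mono' measurableSet_Iio fun y hy => ?_
          rw [mul_left_comm, ← ENNReal.ofReal_mul hK, Real.enorm_eq_ofReal_abs (g x - g y)]
          gcongr
          exact hgK x y (le_of_lt hy)
      _ = ENNReal.ofReal K * ∫⁻ x, ∫⁻ y in Set.Iio x,
            ‖f x - f y‖ₑ * ENNReal.ofReal (deriv ψc x - deriv ψc y) ∂ν ∂ν := by
          simp_rw [lintegral_const_mul' _ _ ENNReal.ofReal_ne_top]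
      _ ≤ ENNReal.ofReal K * ∫⁻ t, ‖deriv f t‖ₑ * ∫⁻ x in Set.Ioi t, ∫⁻ y in Set.Iic t,
            ENNReal.ofReal (deriv ψc x - deriv ψc y) ∂ν ∂ν := by
          exact mul_le_mul_right (lintegral_enorm_sub_mul_le hf hk) _
      _ ≤ ENNReal.ofReal K * ∫⁻ t, ENNReal.ofReal (Real.exp (2 * (M - m))) *
            (((ENNReal.ofReal (∫ y, Real.exp (-(ψc y + δψ y))))⁻¹ *
              ENNReal.ofReal (Real.exp (-(ψc t + δψ t)))) * ‖deriv f t‖ₑ) := by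
          refine mul_le_mul_right (lintegral_mono fun t => ?_) _
          rw [← mul_assoc, mul_comm]
          refine mul_le_mul_left ?_ _
          exact lintegral_Ioi_lintegral_Iic_nuMeas_le hder hc'.continuous hmono hδm hm hM hint t
      _ = _ := by
          rw [lintegral_const_mul' _ _ ENNReal.ofReal_ne_top, hν,
            nuMeas_eq_withDensity _ hψm hint,
            lintegral_withDensity_eq_lintegral_mul _ (by fun_prop) (by fun_prop)]
          rfl
  have hI : 0 ≤ ∫ x, |deriv f x| ∂ν := integral_nonneg fun x => abs_nonneg _
  have hlin : ∫⁻ t, ‖deriv f t‖ₑ ∂ν = ENNReal.ofReal (∫ x, |deriv f x| ∂ν) := by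
    rw [ofReal_integral_eq_lintegral_ofReal hf'i (ae_of_all _ fun x => abs_nonneg _)]
    simp_rw [Real.enorm_eq_ofReal_abs]
  rw [hlin, ← ENNReal.ofReal_mul (Real.exp_pos _).le, ← ENNReal.ofReal_mul hK,
    Real.enorm_eq_ofReal_abs, ENNReal.ofReal_le_ofReal_iff (by positivity)] at hmain
  calc |covFn ν f g| ≤ Real.exp (2 * (M - m)) * K * ∫ x, |deriv f x| ∂ν := by linarith
    _ ≤ Real.exp (3 * (M - m)) * K * ∫ x, |deriv f x| ∂ν := by
      gcongr
      · linarith [hm 0, hM 0]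
      · norm_num
end
end
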